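/- Let f:(ℝ³,0)→(ℝ⁴,0) be a frontal with normal vector ν (not necessarily unit), identifier of singularities λ and null vector field η, and assume ηλ(0)≠0. Let Σ(t,r) be a parametrization of the singular set S(f)=λ⁻¹(0), let f̂(t,r)=f(Σ(t,r)), and define ψ(t,r)=det(f̂_t, f̂_r, ν(Σ(t,r)), (ην)(Σ(t,r))). Then f is a cuspidal cross cap × interval at 0, i.e. A-equivalent to (t,s,r)↦(t,s,r²,sr³), if and only if ψ(0)=0 and dψ₀≠0. -/

import Mathlib

open scoped Topology
open Filter

noncomputable section

/-- Ambient space `ℝ⁴`. -/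
abbrev E4 := Fin 4 → ℝ

/-- The standard inner product on `ℝ⁴`. -/
def dot4 (u v : E4) : ℝ := ∑ i, u i * v i

/-- `det(u,v,w,x)` for four vectors of `ℝ⁴`. -/
def det4 (u v w x : E4) : ℝ := Matrix.det (Matrix.of ![u, v, w, x])

/-- A diffeomorphism-germ at `p`: smooth at `p` with invertible differential. -/
def IsDiffeoGermAt {E : Type*} [NormedAddCommGroup E] [NormedSpace ℝ E]
    (φ : E → E) (p : E) : Prop :=
  ContDiffAt ℝ (⊤ : ℕ∞) φ p ∧ Function.Bijective (fderiv ℝ φ p)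

/-- `f` at `p` is 𝒜-equivalent to the germ of `g` at `0`. -/
def AEquivAt (f : ℝ × ℝ × ℝ → E4) (p : ℝ × ℝ × ℝ) (g : ℝ × ℝ × ℝ → E4) : Prop :=
  ∃ (φ : ℝ × ℝ × ℝ → ℝ × ℝ × ℝ) (Φ : E4 → E4),
    IsDiffeoGermAt φ p ∧ IsDiffeoGermAt Φ (f p) ∧
    φ p = 0 ∧ Φ (f p) = g 0 ∧ ∀ᶠ q in 𝓝 p, Φ (f q) = g (φ q)

lemma param_int_aux {X : Type} [NormedAddCommGroup X] [NormedSpace ℝ X] [FiniteDimensional ℝ X]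
    (n : ℕ) : ∀ (F : Type) [NormedAddCommGroup F] [NormedSpace ℝ F] [FiniteDimensional ℝ F]
      (G : X × ℝ → F), ContDiff ℝ (⊤ : ℕ∞) G →
      ContDiff ℝ n (fun x => ∫ s in (0:ℝ)..1, G (x, s)) := by
  induction n with
  | zero =>
    intro F _ _ _ G hG
    have := intervalIntegral.continuous_parametric_intervalIntegral_of_continuous'
      (μ := MeasureTheory.volume) (f := fun x s => G (x, s)) hG.continuous 0 1
    exact contDiff_zero.2 this
  | succ n ih =>
    intro F _ _ _ G hG
    have hd : ContDiff ℝ (⊤ : ℕ∞) (fun q => (fderiv ℝ G q).comp (ContinuousLinearMap.inl ℝ X ℝ)) :=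
      (hG.fderiv_right (m := (⊤ : ℕ∞)) (by simp)).clm_comp contDiff_const
    have := ih (X →L[ℝ] F) _ hd
    rw [show ((n + 1 : ℕ) : WithTop ℕ∞) = (n : WithTop ℕ∞) + 1 by simp,
      contDiff_succ_iff_hasFDerivAt]
    refine ⟨_, this, fun x => ?_⟩
    obtain ⟨C, hC⟩ := ((isCompact_closedBall x 1).prod (isCompact_Icc (a := (0:ℝ)) (b := 1))).exists_bound_of_continuousOn
      hd.continuous.continuousOn
    refine intervalIntegral.hasFDerivAt_integral_of_dominated_of_fderiv_le
      (F' := fun x s => (fderiv ℝ G (x, s)).comp (ContinuousLinearMap.inl ℝ X ℝ))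
      (bound := fun _ => C) (s := Metric.closedBall x 1) (Metric.closedBall_mem_nhds x one_pos) ?_ ?_ ?_ ?_ ?_ ?_
    · refine Eventually.of_forall fun y => ?_
      exact (hG.continuous.comp (by fun_prop : Continuous fun s : ℝ => (y, s))).aestronglyMeasurable
    · exact (hG.continuous.comp (by fun_prop : Continuous fun s : ℝ => (x, s))).intervalIntegrable _ _
    · exact (hd.continuous.comp (by fun_prop : Continuous fun s : ℝ => (x, s))).aestronglyMeasurable
    · refine Eventually.of_forall fun t ht y hy => hC (y, t) ⟨hy, ?_⟩
      rw [Set.uIoc_of_le zero_le_one] at ht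
      exact ⟨ht.1.le, ht.2⟩
    · exact intervalIntegrable_const
    · refine Eventually.of_forall fun t ht y hy => ?_
      have h1 : HasFDerivAt G (fderiv ℝ G (y, t)) (y, t) :=
        (hG.differentiable (by simp) _).hasFDerivAt
      exact h1.comp y (hasFDerivAt_prodMk_left y t)

lemma param_int {X F : Type} [NormedAddCommGroup X] [NormedSpace ℝ X] [FiniteDimensional ℝ X]
    [NormedAddCommGroup F] [NormedSpace ℝ F] [FiniteDimensional ℝ F]
    {G : X × ℝ → F} (hG : ContDiff ℝ (⊤ : ℕ∞) G) :
    ContDiff ℝ (⊤ : ℕ∞) (fun x => ∫ s in (0:ℝ)..1, G (x, s)) :=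
  contDiff_infty.2 fun n => param_int_aux n F G hG

/-- Hadamard's lemma. -/
lemma hadamard {P F : Type} [NormedAddCommGroup P] [NormedSpace ℝ P] [FiniteDimensional ℝ P]
    [NormedAddCommGroup F] [NormedSpace ℝ F] [FiniteDimensional ℝ F]
    {f : P × ℝ → F} (hf : ContDiff ℝ (⊤ : ℕ∞) f) :
    ∃ h : P × ℝ → F, ContDiff ℝ (⊤ : ℕ∞) h ∧ ∀ u x, f (u, x) = f (u, 0) + x • h (u, x) := by
  have hd : ContDiff ℝ (⊤ : ℕ∞) (fun q : (P × ℝ) × ℝ => fderiv ℝ f (q.1.1, q.2 * q.1.2) (0, 1)) := by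
    have := (hf.fderiv_right (m := (⊤ : ℕ∞)) (by simp))
    refine ContDiff.clm_apply (this.comp (by fun_prop)) contDiff_const
  refine ⟨_, param_int hd, fun u x => ?_⟩
  have key : ∀ s ∈ Set.uIcc (0:ℝ) 1, HasDerivAt (fun s : ℝ => f (u, s * x))
      (x • fderiv ℝ f (u, s * x) (0, 1)) s := by
    intro s _
    have h1 : HasFDerivAt f (fderiv ℝ f (u, s * x)) (u, s * x) :=
      (hf.differentiable (by simp) _).hasFDerivAt
    have h2 : HasDerivAt (fun s : ℝ => (u, s * x)) ((0 : P), x) s := by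
      have := (hasDerivAt_const s u).prodMk ((hasDerivAt_id s).mul_const x)
      simpa using this
    have h3 := h1.comp_hasDerivAt s h2
    have : ((0 : P), x) = x • ((0 : P), (1 : ℝ)) := by simp
    rw [this, map_smul] at h3
    exact h3
  have h4 := intervalIntegral.integral_eq_sub_of_hasDerivAt key ?_
  · simp only [one_mul, zero_mul, intervalIntegral.integral_smul] at h4
    simp only [h4]; abel
  · refine Continuous.intervalIntegrable ?_ _ _
    have := hd.continuous.comp (by fun_prop : Continuous fun s : ℝ => ((u, x), s))
    exact continuous_const.smul this

lemma sqrt_comp_aux {P : Type} [NormedAddCommGroup P] [NormedSpace ℝ P]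
    (m : ℕ) : ∀ (F : Type) [NormedAddCommGroup F] [NormedSpace ℝ F]
      (R : P × ℝ → F), ContDiff ℝ (⊤ : ℕ∞) R → ∀ N, 2 * m + 1 ≤ N →
      ContDiff ℝ m (fun q : P × ℝ => (√q.2 ^ N) • R (q.1, √q.2)) := by
  induction m with
  | zero =>
    intro F _ _ R hR N hN
    refine contDiff_zero.2 ?_
    have : Continuous fun q : P × ℝ => (q.1, √q.2) := by fun_prop
    exact ((Real.continuous_sqrt.comp continuous_snd).pow N).smul (hR.continuous.comp this)
  | succ m ih =>
    intro F _ _ R hR N hN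
    obtain ⟨k, rfl⟩ : ∃ k, N = k + 2 := ⟨N - 2, by omega⟩
    have hR' : ContDiff ℝ (⊤ : ℕ∞) (fderiv ℝ R) := hR.fderiv_right (m := (⊤ : ℕ∞)) (by simp)
    let R2 : P × ℝ → (P × ℝ →L[ℝ] F) := fun q =>
      (q.2 ^ 2) • ((fderiv ℝ R q).comp ((ContinuousLinearMap.inl ℝ P ℝ).comp
          (ContinuousLinearMap.fst ℝ P ℝ))) +
        (ContinuousLinearMap.smulRightL ℝ (P × ℝ) F (ContinuousLinearMap.snd ℝ P ℝ))
          ((((k : ℝ) + 2) / 2) • R q + (q.2 / 2) • fderiv ℝ R q (0, 1))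
    have hR2 : ContDiff ℝ (⊤ : ℕ∞) R2 := by
      refine ContDiff.add ?_ ?_
      · exact (contDiff_snd.pow 2).smul (hR'.clm_comp contDiff_const)
      · refine (ContinuousLinearMap.contDiff _).comp ?_
        refine (contDiff_const.smul hR).add ?_
        exact (contDiff_snd.div_const 2).smul (hR'.clm_apply contDiff_const)
    have h := ih _ R2 hR2 k (by omega)
    rw [show ((m + 1 : ℕ) : WithTop ℕ∞) = (m : WithTop ℕ∞) + 1 by simp,
      contDiff_succ_iff_hasFDerivAt]
    refine ⟨_, h, fun q => ?_⟩
    have hk : k ≠ 0 := by omega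
    rcases lt_trichotomy q.2 0 with hq | hq | hq
    · have h0 : √q.2 = 0 := Real.sqrt_eq_zero_of_nonpos hq.le
      simp only [h0, zero_pow hk, zero_smul]
      refine (hasFDerivAt_const (0 : F) q).congr_of_eventuallyEq ?_
      have : ∀ᶠ q' : P × ℝ in 𝓝 q, q'.2 < 0 := (continuous_snd.tendsto q).eventually (gt_mem_nhds hq)
      filter_upwards [this] with q' hq'
      simp [Real.sqrt_eq_zero_of_nonpos hq'.le]
    · have h0 : √q.2 = 0 := by simp [hq]
      simp only [h0, zero_pow hk, zero_smul]
      refine HasFDerivAt.of_isLittleO ?_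
      simp only [h0, zero_pow (show k + 2 ≠ 0 by omega), zero_smul, sub_zero,
        zero_apply]
      have hc : Continuous (fun q : P × ℝ => (√q.2 ^ k) • R (q.1, √q.2)) := by
        have : Continuous fun q : P × ℝ => (q.1, √q.2) := by fun_prop
        exact ((Real.continuous_sqrt.comp continuous_snd).pow k).smul (hR.continuous.comp this)
      have ho : (fun q : P × ℝ => (√q.2 ^ k) • R (q.1, √q.2)) =o[𝓝 q] (fun _ => (1 : ℝ)) := by
        rw [Asymptotics.isLittleO_one_iff]
        have := hc.tendsto q
        simpa [h0, zero_pow hk] using this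
      have hO : (fun q' : P × ℝ => √q'.2 ^ 2) =O[𝓝 q] (fun q' => q' - q) := by
        refine Asymptotics.IsBigO.of_bound 1 (Eventually.of_forall fun q' => ?_)
        rw [one_mul]
        have h1 : ‖√q'.2 ^ 2‖ ≤ |q'.2| := by
          rw [Real.norm_eq_abs, abs_of_nonneg (sq_nonneg _)]
          rcases le_or_gt 0 q'.2 with h | h
          · rw [Real.sq_sqrt h]; exact le_abs_self _
          · simp [Real.sqrt_eq_zero_of_nonpos h.le]
        refine h1.trans ?_
        have := norm_snd_le (q' - q)
        simpa [hq] using this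
      have := hO.norm_right.smul_isLittleO ho
      have h3 := this
      simp only [smul_eq_mul, mul_one] at h3
      refine (h3.congr_left fun q' => ?_).of_norm_right
      rw [smul_smul]; ring_nf
    · have hs : √q.2 ≠ 0 := (Real.sqrt_pos.2 hq).ne'
      have h1 : HasFDerivAt (fun q : P × ℝ => √q.2) ((1 / (2 * √q.2)) • ContinuousLinearMap.snd ℝ P ℝ) q :=
        (Real.hasDerivAt_sqrt hq.ne').comp_hasFDerivAt q hasFDerivAt_snd
      have h2 : HasFDerivAt R (fderiv ℝ R (q.1, √q.2)) (q.1, √q.2) :=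
        (hR.differentiable (by simp) _).hasFDerivAt
      have h3 := h2.comp q ((hasFDerivAt_fst (p := q)).prodMk h1)
      have h4 := (h1.pow (k + 2)).smul h3
      refine h4.congr_fderiv ?_
      ext v
      · simp [R2]
        rw [smul_smul]; ring_nf
      · simp only [R2]
        have : fderiv ℝ R (q.1, √q.2) (0, (1 / (2 * √q.2))) = (1 / (2 * √q.2)) • fderiv ℝ R (q.1, √q.2) (0, 1) := by
          rw [← map_smul]; simp
        simp at this
        have h00 : fderiv ℝ R (q.1, √q.2) ((0 : P), (0 : ℝ)) = 0 := map_zero (fderiv ℝ R (q.1, √q.2))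
        simp [this, h00]
        match_scalars <;> field_simp <;> ring

lemma borel_aux {P : Type} [NormedAddCommGroup P] [NormedSpace ℝ P] [FiniteDimensional ℝ P]
    (h : ℕ → P → ℝ) (hh : ∀ k, ContDiff ℝ (⊤ : ℕ∞) (h k)) :
    ∃ H : P × ℝ → ℝ, ∀ N : ℕ, ∃ T : P × ℝ → ℝ, ContDiff ℝ (⊤ : ℕ∞) T ∧
      ∀ᶠ q in 𝓝 (0 : P × ℝ),
        H q = ∑ k ∈ Finset.range N, h k q.1 * q.2 ^ k + q.2 ^ N * T q := by
  let β : ContDiffBump (0 : P) := ⟨1, 2, one_pos, one_lt_two⟩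
  let χ : ContDiffBump (0 : ℝ) := ⟨1, 2, one_pos, one_lt_two⟩
  let G : ℕ → ℕ → P × ℝ → ℝ := fun N j q => (β q.1 * χ q.2) * (h (N + j) q.1 * q.2 ^ j)
  have hG : ∀ N j, ContDiff ℝ (⊤ : ℕ∞) (G N j) := fun N j =>
    ((β.contDiff.comp contDiff_fst).mul (χ.contDiff.comp contDiff_snd)).mul
      (((hh _).comp contDiff_fst).mul (contDiff_snd.pow j))
  have hGs : ∀ N j, HasCompactSupport (G N j) := by
    intro N j
    refine HasCompactSupport.mul_right ?_
    refine HasCompactSupport.intro (β.hasCompactSupport.isCompact.prod χ.hasCompactSupport.isCompact) ?_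
    intro q hq
    by_contra hne
    exact hq ⟨subset_tsupport _ (left_ne_zero_of_mul hne), subset_tsupport _ (right_ne_zero_of_mul hne)⟩
  have hbd : ∀ N j m, ∃ C, ∀ q, ‖iteratedFDeriv ℝ m (G N j) q‖ ≤ C := fun N j m =>
    ((hG N j).continuous_iteratedFDeriv (by exact_mod_cast le_top)).bounded_above_of_compact_support
      ((hGs N j).iteratedFDeriv m)
  choose C hC using hbd
  have hC0 : ∀ N j m, 0 ≤ C N j m := fun N j m => (norm_nonneg _).trans (hC N j m 0)
  let D : ℕ → ℝ := fun k => ∑ i ∈ Finset.range (k + 1), ∑ m ∈ Finset.range (k + 1), C i (k - i) m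
  have hD0 : ∀ k, 0 ≤ D k := fun k => Finset.sum_nonneg fun i _ => Finset.sum_nonneg fun m _ => hC0 _ _ _
  have hCD : ∀ N j m, m ≤ N + j → C N j m ≤ D (N + j) := by
    intro N j m hm
    have h1 : ∑ m ∈ Finset.range (N + j + 1), C N (N + j - N) m ≤ D (N + j) :=
      Finset.single_le_sum (f := fun i => ∑ m ∈ Finset.range (N + j + 1), C i (N + j - i) m)
        (fun i _ => Finset.sum_nonneg fun m _ => hC0 _ _ _) (by simp)
    have h2 : C N (N + j - N) m ≤ ∑ m ∈ Finset.range (N + j + 1), C N (N + j - N) m :=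
      Finset.single_le_sum (f := fun m => C N (N + j - N) m) (fun m _ => hC0 _ _ _) (by simp; omega)
    simpa using h2.trans h1
  let ε : ℕ → ℝ := fun k => (1 / 2) ^ k / (1 + D k)
  have hε0 : ∀ k, 0 < ε k := fun k => div_pos (by positivity) (by linarith [hD0 k])
  have hε1 : ∀ k, ε k ≤ 1 := fun k => by
    rw [div_le_one (by linarith [hD0 k])]
    have : (1 / 2 : ℝ) ^ k ≤ 1 := pow_le_one₀ (by norm_num) (by norm_num)
    linarith [hD0 k]
  have hεD : ∀ k, ε k * D k ≤ (1 / 2) ^ k := fun k => by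
    have h1 : 0 < 1 + D k := by linarith [hD0 k]
    rw [div_mul_eq_mul_div, div_le_iff₀ h1]
    have : (0:ℝ) < (1 / 2) ^ k := by positivity
    nlinarith
  let t : ℕ → ℕ → P × ℝ → ℝ := fun N j q =>
    (β q.1 * χ ((ε (N + j))⁻¹ * q.2)) * (h (N + j) q.1 * q.2 ^ j)
  let A : ℝ → (P × ℝ →L[ℝ] P × ℝ) := fun c =>
    (ContinuousLinearMap.fst ℝ P ℝ).prod (c • ContinuousLinearMap.snd ℝ P ℝ)
  have hA : ∀ c, 1 ≤ c → ‖A c‖ ≤ c := by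
    intro c hc
    refine ContinuousLinearMap.opNorm_le_bound _ (by linarith) fun q => ?_
    have e : A c q = (q.1, c * q.2) := rfl
    rw [e, Prod.norm_mk]
    refine max_le ?_ ?_
    · have := norm_fst_le q
      nlinarith [norm_nonneg q]
    · rw [norm_mul, Real.norm_of_nonneg (by linarith : (0:ℝ) ≤ c)]
      exact mul_le_mul_of_nonneg_left (norm_snd_le q) (by linarith)
  have htG : ∀ N j, t N j = (ε (N + j) ^ j) • (G N j ∘ A (ε (N + j))⁻¹) := by
    intro N j
    ext q
    have := (hε0 (N + j)).ne'
    simp only [t, G, A, Pi.smul_apply, Function.comp, ContinuousLinearMap.prod_apply, smul_eq_mul,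
      ContinuousLinearMap.coe_fst', smul_apply, ContinuousLinearMap.coe_snd', mul_pow, inv_pow]
    field_simp
  have htc : ∀ N j, ContDiff ℝ (⊤ : ℕ∞) (t N j) := by
    intro N j
    rw [htG]
    exact contDiff_const.smul ((hG N j).comp (A _).contDiff)
  have htb : ∀ N j m, m + 1 ≤ j → ∀ q, ‖iteratedFDeriv ℝ m (t N j) q‖ ≤ (1 / 2) ^ j := by
    intro N j m hm q
    have e0 := hε0 (N + j)
    have e1 := hε1 (N + j)
    rw [htG, iteratedFDeriv_const_smul_apply
      (((hG N j).comp (A _).contDiff).contDiffAt.of_le (by exact_mod_cast le_top)), norm_smul,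
      ContinuousLinearMap.iteratedFDeriv_comp_right _ (hG N j) _ (by exact_mod_cast le_top)]
    have hinv : 1 ≤ (ε (N + j))⁻¹ := (one_le_inv₀ e0).2 e1
    have s1 := ContinuousMultilinearMap.norm_compContinuousLinearMap_le
      (iteratedFDeriv ℝ m (G N j) (A (ε (N + j))⁻¹ q)) (fun _ : Fin m => A (ε (N + j))⁻¹)
    rw [Finset.prod_const, Finset.card_univ, Fintype.card_fin] at s1
    have s2 : ‖A (ε (N + j))⁻¹‖ ^ m ≤ (ε (N + j))⁻¹ ^ m :=
      pow_le_pow_left₀ (norm_nonneg _) (hA _ hinv) m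
    have s3 := (hC N j m (A (ε (N + j))⁻¹ q)).trans (hCD N j m (by omega))
    have s4 : ‖iteratedFDeriv ℝ m (G N j) (A (ε (N + j))⁻¹ q)‖ * ‖A (ε (N + j))⁻¹‖ ^ m ≤
        D (N + j) * (ε (N + j))⁻¹ ^ m := mul_le_mul s3 s2 (by positivity) (hD0 _)
    have s5 : ‖ε (N + j) ^ j‖ = ε (N + j) ^ j := Real.norm_of_nonneg (by positivity)
    rw [s5]
    refine (mul_le_mul_of_nonneg_left (s1.trans s4) (by positivity)).trans ?_
    obtain ⟨i, rfl⟩ : ∃ i, j = m + (i + 1) := ⟨j - m - 1, by omega⟩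
    have s6 : ε (N + (m + (i + 1))) ^ (m + (i + 1)) *
        (D (N + (m + (i + 1))) * (ε (N + (m + (i + 1))))⁻¹ ^ m) =
        ε (N + (m + (i + 1))) ^ i * (ε (N + (m + (i + 1))) * D (N + (m + (i + 1)))) := by
      rw [pow_add, inv_pow, pow_succ]
      field_simp
    rw [s6]
    have s7 : ε (N + (m + (i + 1))) ^ i ≤ 1 := pow_le_one₀ e0.le e1
    have s8 := hεD (N + (m + (i + 1)))
    have s9 : (1 / 2 : ℝ) ^ (N + (m + (i + 1))) ≤ (1 / 2) ^ (m + (i + 1)) :=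
      pow_le_pow_of_le_one (by norm_num) (by norm_num) (by omega)
    calc _ ≤ 1 * (ε (N + (m + (i + 1))) * D (N + (m + (i + 1)))) :=
          mul_le_mul_of_nonneg_right s7 (mul_nonneg e0.le (hD0 _))
      _ ≤ _ := by linarith
  have hsum2 : Summable fun j : ℕ => (1 / 2 : ℝ) ^ j := summable_geometric_two
  have hT : ∀ N, ContDiff ℝ (⊤ : ℕ∞) fun q => ∑' j, t N j q := by
    intro N
    refine contDiff_tsum_of_eventually (v := fun _ j => (1 / 2 : ℝ) ^ j) (htc N) (fun _ _ => hsum2) ?_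
    intro m _
    rw [Nat.cofinite_eq_atTop]
    filter_upwards [eventually_ge_atTop (m + 1)] with j hj
    exact htb N j m hj
  have hts : ∀ N q, Summable fun j => t N j q := by
    intro N q
    refine Summable.of_norm_bounded_eventually hsum2 ?_
    rw [Nat.cofinite_eq_atTop]
    filter_upwards [eventually_ge_atTop 1] with j hj
    have := htb N j 0 hj q
    rwa [norm_iteratedFDeriv_zero] at this
  refine ⟨fun q => ∑' j, t 0 j q, fun N => ⟨fun q => ∑' j, t N j q, hT N, ?_⟩⟩
  have e1 : ∀ᶠ q : P × ℝ in 𝓝 0, β q.1 = 1 :=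
    (continuous_fst.tendsto (0 : P × ℝ)).eventually β.eventuallyEq_one
  have e2 : ∀ᶠ q : P × ℝ in 𝓝 0, ∀ k ∈ Finset.range N, χ ((ε k)⁻¹ * q.2) = 1 := by
    rw [eventually_all_finset]
    intro k _
    have : Tendsto (fun q : P × ℝ => (ε k)⁻¹ * q.2) (𝓝 0) (𝓝 0) := by
      have : Continuous (fun q : P × ℝ => (ε k)⁻¹ * q.2) := by fun_prop
      simpa using this.tendsto 0
    exact this.eventually χ.eventuallyEq_one
  filter_upwards [e1, e2] with q h1 h2
  rw [← (hts 0 q).sum_add_tsum_nat_add N]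
  congr 1
  · refine Finset.sum_congr rfl fun k hk => ?_
    simp only [t, zero_add, h1, h2 k hk]
    ring
  · rw [← tsum_mul_left]
    refine tsum_congr fun j => ?_
    simp only [t, zero_add, add_comm j N, pow_add]
    ring

lemma even_step {P : Type} [NormedAddCommGroup P] [NormedSpace ℝ P] [FiniteDimensional ℝ P]
    (w : P × ℝ → ℝ) (hw : ContDiff ℝ (⊤ : ℕ∞) w) (he : ∀ p x, w (p, -x) = w (p, x)) :
    ∃ w' : P × ℝ → ℝ, ContDiff ℝ (⊤ : ℕ∞) w' ∧ (∀ p x, w' (p, -x) = w' (p, x)) ∧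
      ∀ p x, w (p, x) = w (p, 0) + x ^ 2 * w' (p, x) := by
  obtain ⟨h, hh, h1⟩ := hadamard hw
  have hodd : ∀ p x, x ≠ 0 → h (p, -x) = - h (p, x) := by
    intro p x hx
    have a := h1 p x
    have b := h1 p (-x)
    rw [he] at b
    simp only [smul_eq_mul] at a b
    have : x * (h (p, -x) + h (p, x)) = 0 := by linarith
    have := (mul_eq_zero.1 this).resolve_left hx
    linarith
  have hz : ∀ p, h (p, 0) = 0 := by
    intro p
    have hc : Continuous fun x : ℝ => h (p, -x) + h (p, x) := by
      have := hh.continuous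
      fun_prop
    have : Tendsto (fun x : ℝ => h (p, -x) + h (p, x)) (𝓝[≠] 0) (𝓝 (h (p, -0) + h (p, 0))) :=
      (hc.tendsto 0).mono_left nhdsWithin_le_nhds
    have h2 : Tendsto (fun x : ℝ => h (p, -x) + h (p, x)) (𝓝[≠] 0) (𝓝 0) := by
      refine tendsto_const_nhds.congr' ?_
      filter_upwards [self_mem_nhdsWithin] with x hx
      rw [hodd p x hx]; ring
    have := tendsto_nhds_unique this h2
    rw [neg_zero] at this
    linarith
  obtain ⟨w', hw', h2⟩ := hadamard hh
  refine ⟨w', hw', ?_, ?_⟩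
  · intro p x
    rcases eq_or_ne x 0 with rfl | hx
    · simp
    · have a := h2 p x
      have b := h2 p (-x)
      rw [hodd p x hx] at b
      rw [hz] at a b
      simp only [smul_eq_mul] at a b
      have : x * (w' (p, -x) - w' (p, x)) = 0 := by linarith
      have := (mul_eq_zero.1 this).resolve_left hx
      linarith
  · intro p x
    rw [h1 p x, h2 p x, hz]
    simp only [smul_eq_mul]; ring

lemma whitney_even {P : Type} [NormedAddCommGroup P] [NormedSpace ℝ P] [FiniteDimensional ℝ P]
    (w : P × ℝ → ℝ) (hw : ContDiff ℝ (⊤ : ℕ∞) w) (he : ∀ p x, w (p, -x) = w (p, x)) :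
    ∃ E : P × ℝ → ℝ, ContDiffAt ℝ (⊤ : ℕ∞) E 0 ∧ ∀ p x, w (p, x) = E (p, x ^ 2) := by
  let W := {w : P × ℝ → ℝ // ContDiff ℝ (⊤ : ℕ∞) w ∧ ∀ p x, w (p, -x) = w (p, x)}
  have hstep : ∀ w : W, ∃ w' : W, ∀ p x, w.1 (p, x) = w.1 (p, 0) + x ^ 2 * w'.1 (p, x) := by
    rintro ⟨w, h1, h2⟩
    obtain ⟨w', a, b, c⟩ := even_step w h1 h2
    exact ⟨⟨w', a, b⟩, c⟩
  choose S hS using hstep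
  let s : ℕ → W := fun k => S^[k] ⟨w, hw, he⟩
  have hs : ∀ k p x, (s k).1 (p, x) = (s k).1 (p, 0) + x ^ 2 * (s (k + 1)).1 (p, x) := by
    intro k p x
    simp only [s, Function.iterate_succ_apply']
    exact hS _ p x
  have hsN : ∀ N p x, w (p, x) = ∑ k ∈ Finset.range N, (s k).1 (p, 0) * (x ^ 2) ^ k +
      (x ^ 2) ^ N * (s N).1 (p, x) := by
    intro N p x
    induction N with
    | zero => simp [s]
    | succ N ih =>
      rw [ih, Finset.sum_range_succ, hs N p x]; ring
  obtain ⟨H, hH⟩ := borel_aux (fun k p => (s k).1 (p, 0))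
    (fun k => (s k).2.1.comp (contDiff_id.prodMk contDiff_const))
  refine ⟨fun q => H q + (w (q.1, √q.2) - H (q.1, √q.2 ^ 2)), ?_, ?_⟩
  · refine ContDiffAt.add ?_ ?_
    · obtain ⟨T, hT, h0⟩ := hH 0
      refine hT.contDiffAt.congr_of_eventuallyEq ?_
      filter_upwards [h0] with q hq
      simpa using hq
    · rw [contDiffAt_infty]
      intro m
      obtain ⟨T, hT, hN⟩ := hH (2 * m + 1)
      let R : P × ℝ → ℝ := fun q => (s (2 * m + 1)).1 q - T (q.1, q.2 ^ 2)
      have hR : ContDiff ℝ (⊤ : ℕ∞) R :=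
        (s (2 * m + 1)).2.1.sub (hT.comp (contDiff_fst.prodMk (contDiff_snd.pow 2)))
      have := sqrt_comp_aux m ℝ R hR (2 * (2 * m + 1)) (by omega)
      refine this.contDiffAt.congr_of_eventuallyEq ?_
      have ht : Tendsto (fun q : P × ℝ => (q.1, √q.2 ^ 2)) (𝓝 0) (𝓝 0) := by
        have : Continuous (fun q : P × ℝ => (q.1, √q.2 ^ 2)) := by fun_prop
        have := this.tendsto 0
        simp at this
        exact this
      filter_upwards [ht.eventually hN] with q hq
      rw [hq, hsN (2 * m + 1) q.1 (√q.2)]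
      simp only [R, smul_eq_mul]
      rw [pow_mul]
      ring
  · intro p x
    simp only [Real.sqrt_sq_eq_abs, sq_abs]
    rcases abs_choice x with h | h <;> rw [h]
    · ring
    · rw [he]; ring

/-- Even/odd splitting. -/
lemma whitney_split {P : Type} [NormedAddCommGroup P] [NormedSpace ℝ P] [FiniteDimensional ℝ P]
    (e : P × ℝ → ℝ) (he : ContDiff ℝ (⊤ : ℕ∞) e) :
    ∃ E1 E2 : P × ℝ → ℝ, ContDiffAt ℝ (⊤ : ℕ∞) E1 0 ∧ ContDiffAt ℝ (⊤ : ℕ∞) E2 0 ∧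
      ∀ p x, e (p, x) = E1 (p, x ^ 2) + x * E2 (p, x ^ 2) := by
  have hneg : ContDiff ℝ (⊤ : ℕ∞) fun q : P × ℝ => e (q.1, -q.2) :=
    he.comp (contDiff_fst.prodMk contDiff_snd.neg)
  obtain ⟨E1, h1, h1'⟩ := whitney_even (fun q : P × ℝ => (e q + e (q.1, -q.2)) / 2)
    ((he.add hneg).div_const 2) (by intro p x; simp [add_comm])
  obtain ⟨h, hh, hx⟩ := hadamard (f := fun q : P × ℝ => (e q - e (q.1, -q.2)) / 2)
    ((he.sub hneg).div_const 2)
  simp only [neg_zero, sub_self, zero_div, zero_add, smul_eq_mul] at hx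
  obtain ⟨E2, h2, h2'⟩ := whitney_even h hh (by
    intro p x
    rcases eq_or_ne x 0 with rfl | h0
    · simp
    · have a := hx p x
      have b := hx p (-x)
      rw [neg_neg] at b
      have : x * (h (p, -x) - h (p, x)) = 0 := by linarith
      have := (mul_eq_zero.1 this).resolve_left h0
      linarith)
  refine ⟨E1, E2, h1, h2, fun p x => ?_⟩
  rw [← h1', ← h2', ← hx]
  ring

lemma det4_expand (a b c d : E4) : det4 a b c d =
    (a 0 * b 1 - a 1 * b 0) * (c 2 * d 3 - c 3 * d 2)
    - (a 0 * b 2 - a 2 * b 0) * (c 1 * d 3 - c 3 * d 1)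
    + (a 0 * b 3 - a 3 * b 0) * (c 1 * d 2 - c 2 * d 1)
    + (a 1 * b 2 - a 2 * b 1) * (c 0 * d 3 - c 3 * d 0)
    - (a 1 * b 3 - a 3 * b 1) * (c 0 * d 2 - c 2 * d 0)
    + (a 2 * b 3 - a 3 * b 2) * (c 0 * d 1 - c 1 * d 0) := by
  simp [det4, Matrix.det_succ_row_zero, Fin.sum_univ_succ, Fin.succAbove]
  ring

lemma det4_map (L : E4 →L[ℝ] E4) (a b c d : E4) :
    det4 (L a) (L b) (L c) (L d) = LinearMap.det (L : E4 →ₗ[ℝ] E4) * det4 a b c d := by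
  have : Matrix.of ![L a, L b, L c, L d] =
      Matrix.of ![a, b, c, d] * (LinearMap.toMatrix' (L : E4 →ₗ[ℝ] E4)).transpose := by
    have key : ∀ v : E4, ∀ j, L v j = ∑ k, v k * LinearMap.toMatrix' (L : E4 →ₗ[ℝ] E4) j k := by
      intro v j
      have := congrFun (LinearMap.toMatrix'_mulVec (L : E4 →ₗ[ℝ] E4) v) j
      rw [Matrix.mulVec, dotProduct] at this
      rw [show L v j = (L : E4 →ₗ[ℝ] E4) v j from rfl, ← this]
      exact Finset.sum_congr rfl fun k _ => mul_comm _ _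
    ext i j
    rw [Matrix.mul_apply]
    fin_cases i
    · exact key a j
    · exact key b j
    · exact key c j
    · exact key d j
  rw [det4, this, Matrix.det_mul, Matrix.det_transpose, LinearMap.det_toMatrix', mul_comm, det4]

lemma quad_bound {E F : Type*} [NormedAddCommGroup E] [NormedSpace ℝ E]
    [NormedAddCommGroup F] [NormedSpace ℝ F] {Φ : E → F} {p : E} (hΦ : ContDiffAt ℝ 2 Φ p) :
    ∃ C, ∀ᶠ d in 𝓝 (0 : E), ‖Φ (p + d) - Φ p - fderiv ℝ Φ p d‖ ≤ C * ‖d‖ ^ 2 := by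
  have h1 : ContDiffAt ℝ 1 (fderiv ℝ Φ) p := hΦ.fderiv_right (m := 1) (by norm_num)
  obtain ⟨K, t, ht, hK⟩ := h1.exists_lipschitzOnWith
  have h2 : ∀ᶠ q in 𝓝 p, DifferentiableAt ℝ Φ q := by
    have := hΦ.eventually (by simp)
    filter_upwards [this] with q hq using hq.differentiableAt (by simp)
  obtain ⟨r, hr, hball⟩ := Metric.mem_nhds_iff.1 (inter_mem ht h2)
  refine ⟨K, ?_⟩
  filter_upwards [Metric.ball_mem_nhds (0 : E) hr] with d hd
  have hsub : Metric.closedBall p ‖d‖ ⊆ Metric.ball p r :=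
    Metric.closedBall_subset_ball (by simpa using hd)
  have := (convex_closedBall p ‖d‖).norm_image_sub_le_of_norm_hasFDerivWithin_le'
    (f := Φ) (f' := fun q => fderiv ℝ Φ q) (φ := fderiv ℝ Φ p) (C := K * ‖d‖) (x := p) (y := p + d)
    (fun q hq => ((hball (hsub hq)).2 : DifferentiableAt ℝ Φ q).hasFDerivAt.hasFDerivWithinAt)
    (fun q hq => ?_) (by simp) (by simp)
  · simp only [add_sub_cancel_left] at this
    rw [pow_two, ← mul_assoc]; exact this
  · have := hK.norm_sub_le (hball (hsub hq)).1 (mem_of_mem_nhds ht)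
    refine this.trans ?_
    gcongr
    simpa [dist_eq_norm] using hq

/-- Second order expansion along a cuspidal curve. -/
lemma curve_expand {E F : Type*} [NormedAddCommGroup E] [NormedSpace ℝ E]
    [NormedAddCommGroup F] [NormedSpace ℝ F] {Φ : E → F} {p : E} (hΦ : ContDiffAt ℝ 2 Φ p)
    {v : ℝ → E} {v1 : E} (hv : HasDerivAt v v1 0) :
    ∃ r : ℝ → F, r 0 = fderiv ℝ Φ p (v 0) ∧ HasDerivAt r (fderiv ℝ Φ p v1) 0 ∧
      ∀ x, Φ (p + x ^ 2 • v x) = Φ p + x ^ 2 • r x := by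
  obtain ⟨C, hC⟩ := quad_bound hΦ
  let s : ℝ → F := fun x => (x ^ 2)⁻¹ • (Φ (p + x ^ 2 • v x) - Φ p - fderiv ℝ Φ p (x ^ 2 • v x))
  have hs0 : s 0 = 0 := by simp [s]
  have hvc := hv.continuousAt
  have hs : HasDerivAt s 0 0 := by
    rw [hasDerivAt_iff_isLittleO]
    simp only [hs0, sub_zero, smul_zero]
    have ht : Tendsto (fun x : ℝ => x ^ 2 • v x) (𝓝 0) (𝓝 0) := by
      have : ContinuousAt (fun x : ℝ => x ^ 2 • v x) 0 := by fun_prop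
      simpa [ContinuousAt] using this
    have hb : ∀ᶠ x in 𝓝 (0:ℝ), ‖s x‖ ≤ ‖(C * ‖v x‖ ^ 2 * x) * x‖ := by
      filter_upwards [ht.eventually hC] with x hx
      rcases eq_or_ne x 0 with rfl | h0
      · simp [hs0]
      · simp only [s, norm_smul]
        have hx2 : 0 < x ^ 2 := by positivity
        rw [norm_inv, Real.norm_of_nonneg hx2.le, inv_mul_le_iff₀ hx2]
        refine hx.trans ?_
        rw [norm_smul, Real.norm_of_nonneg hx2.le]
        have : C * ‖v x‖ ^ 2 * x * x ≤ ‖C * ‖v x‖ ^ 2 * x * x‖ := Real.le_norm_self _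
        nlinarith
    have hO : s =O[𝓝 0] (fun x => (C * ‖v x‖ ^ 2 * x) * x) :=
      Asymptotics.IsBigO.of_bound 1 (by filter_upwards [hb] with x hx using by rw [one_mul]; exact hx)
    refine hO.trans_isLittleO ?_
    have h1 : (fun x : ℝ => C * ‖v x‖ ^ 2 * x) =o[𝓝 0] (fun _ => (1:ℝ)) := by
      rw [Asymptotics.isLittleO_one_iff]
      have : ContinuousAt (fun x : ℝ => C * ‖v x‖ ^ 2 * x) 0 := by fun_prop
      simpa [ContinuousAt] using this
    simpa using h1.mul_isBigO (Asymptotics.isBigO_refl (fun x : ℝ => x) (𝓝 0))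
  refine ⟨fun x => fderiv ℝ Φ p (v x) + s x, by simp [hs0], ?_, ?_⟩
  · have := ((fderiv ℝ Φ p).hasFDerivAt.comp_hasDerivAt (0:ℝ) hv).add hs
    rw [add_zero] at this
    exact this
  · intro x
    rcases eq_or_ne x 0 with rfl | h0
    · simp
    · simp only [s]
      rw [smul_add, smul_smul, mul_inv_cancel₀ (by positivity), one_smul, map_smul]
      abel

lemma curve_key {Φ : E4 → E4} {p : E4} (hΦ : ContDiffAt ℝ 2 Φ p)
    {v : ℝ → E4} {v1 : E4} (hv : HasDerivAt v v1 0)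
    {a : ℝ → ℝ × ℝ} {y : ℝ → ℝ} {b : ℝ} (hy : HasDerivAt y b 0) (hy0 : y 0 = 0)
    {e : (ℝ × ℝ) × ℝ → ℝ} (he : DifferentiableAt ℝ e (a 0, 0))
    (heq : ∀ᶠ x in 𝓝 (0:ℝ), Φ (p + x ^ 2 • v x) =
      ![(a x).1, (a x).2, y x ^ 2, y x ^ 2 * e (a x, y x)]) :
    HasDerivAt a 0 0 ∧
    (fderiv ℝ Φ p (v 0)) 2 * (fderiv ℝ Φ p v1) 3 - (fderiv ℝ Φ p (v 0)) 3 * (fderiv ℝ Φ p v1) 2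
      = b ^ 5 * fderiv ℝ e (a 0, 0) (0, 1) := by
  obtain ⟨r, hr0, hr1, hr⟩ := curve_expand hΦ hv
  have hp : Φ p = ![(a 0).1, (a 0).2, 0, 0] := by
    have := heq.self_of_nhds
    simpa [hy0] using this
  have hx : ∀ᶠ x in 𝓝 (0:ℝ), (a x).1 = (a 0).1 + x ^ 2 * r x 0 ∧ (a x).2 = (a 0).2 + x ^ 2 * r x 1 ∧
      y x ^ 2 = x ^ 2 * r x 2 ∧ y x ^ 2 * e (a x, y x) = x ^ 2 * r x 3 := by
    filter_upwards [heq] with x hx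
    rw [hr, hp] at hx
    have h0 := congrFun hx 0
    have h1 := congrFun hx 1
    have h2 := congrFun hx 2
    have h3 := congrFun hx 3
    simp at h0 h1 h2 h3
    exact ⟨h0.symm, h1.symm, h2.symm, h3.symm⟩
  have hri : ∀ i, HasDerivAt (fun x => r x i) (fderiv ℝ Φ p v1 i) 0 := hasDerivAt_pi.1 hr1
  have hsq : ∀ i (c : ℝ), HasDerivAt (fun x => c + x ^ 2 * r x i) 0 0 := by
    intro i c
    have := (((hasDerivAt_id (0:ℝ)).pow 2).mul (hri i)).const_add c
    simpa using this
  have ha : HasDerivAt a 0 0 := by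
    have h1 := (hsq 0 (a 0).1).prodMk (hsq 1 (a 0).2)
    refine HasDerivAt.congr_of_eventuallyEq h1 ?_
    filter_upwards [hx] with x hx
    exact Prod.ext hx.1 hx.2.1
  refine ⟨ha, ?_⟩
  have hε : HasDerivAt (fun x => e (a x, y x)) (b * fderiv ℝ e (a 0, 0) (0, 1)) 0 := by
    have h1 : HasFDerivAt e (fderiv ℝ e (a 0, 0)) (a 0, y 0) := by rw [hy0]; exact he.hasFDerivAt
    have h2 := h1.comp_hasDerivAt (0:ℝ) (ha.prodMk hy)
    have h3 : ((0 : ℝ × ℝ), b) = b • ((0 : ℝ × ℝ), (1:ℝ)) := by simp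
    rw [h3, map_smul] at h2
    exact h2
  have hr2 : r 0 2 = b ^ 2 := by
    have h1 : Tendsto (fun x : ℝ => (x⁻¹ * y x) ^ 2) (𝓝[≠] 0) (𝓝 (b ^ 2)) := by
      have := hy.tendsto_slope_zero
      simp only [zero_add, hy0, sub_zero, smul_eq_mul] at this
      exact this.pow 2
    have h2 : Tendsto (fun x : ℝ => r x 2) (𝓝[≠] 0) (𝓝 (r 0 2)) :=
      (hri 2).continuousAt.tendsto.mono_left nhdsWithin_le_nhds
    refine tendsto_nhds_unique (h2.congr' ?_) h1
    filter_upwards [self_mem_nhdsWithin, hx.filter_mono nhdsWithin_le_nhds] with x h0 hx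
    have h0 : x ≠ 0 := h0
    rw [mul_pow, hx.2.2.1]; field_simp
  have h3ne : ∀ᶠ x in 𝓝[≠] (0:ℝ), r x 3 = r x 2 * e (a x, y x) := by
    filter_upwards [self_mem_nhdsWithin, hx.filter_mono nhdsWithin_le_nhds] with x h0 hx
    have h0 : x ^ 2 ≠ 0 := pow_ne_zero 2 h0
    have := hx.2.2.2
    rw [hx.2.2.1] at this
    apply mul_left_cancel₀ h0
    linarith
  have hprod := (hri 2).mul hε
  have h30 : r 0 3 = r 0 2 * e (a 0, y 0) := by
    have h2 : Tendsto (fun x : ℝ => r x 3) (𝓝[≠] 0) (𝓝 (r 0 3)) :=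
      (hri 3).continuousAt.tendsto.mono_left nhdsWithin_le_nhds
    have h1 : Tendsto (fun x : ℝ => r x 2 * e (a x, y x)) (𝓝[≠] 0) (𝓝 (r 0 2 * e (a 0, y 0))) :=
      hprod.continuousAt.tendsto.mono_left nhdsWithin_le_nhds
    exact tendsto_nhds_unique h2 (h1.congr' (h3ne.mono fun x hx => hx.symm))
  have h3 : ∀ᶠ x in 𝓝 (0:ℝ), r x 3 = r x 2 * e (a x, y x) := by
    rw [eventually_nhdsWithin_iff] at h3ne
    filter_upwards [h3ne] with x hx
    rcases eq_or_ne x 0 with rfl | h0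
    · exact h30
    · exact hx h0
  have hd := (hri 3).unique (hprod.congr_of_eventuallyEq h3)
  rw [← hr0, hd, h30, hr2]
  ring

lemma hasFDerivAt_mul_vanish {X : Type*} [NormedAddCommGroup X] [NormedSpace ℝ X]
    {κ G : X → ℝ} {G' : X →L[ℝ] ℝ} {x : X} (hκ : ContinuousAt κ x) (hG : HasFDerivAt G G' x)
    (h0 : G x = 0) : HasFDerivAt (fun q => κ q * G q) (κ x • G') x := by
  refine HasFDerivAt.of_isLittleO ?_
  have h1 : (fun q => κ q * (G q - G x - G' (q - x))) =o[𝓝 x] fun q => q - x := by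
    have h2 := (hκ.isBigO_one ℝ).mul_isLittleO hG.isLittleO.norm_right
    simpa using h2
  have h2 : (fun q => (κ q - κ x) * G' (q - x)) =o[𝓝 x] fun q => q - x := by
    have h3 : (fun q => κ q - κ x) =o[𝓝 x] fun _ => (1:ℝ) := by
      rw [Asymptotics.isLittleO_one_iff]
      have : ContinuousAt (fun q => κ q - κ x) x := hκ.sub continuousAt_const
      simpa [ContinuousAt] using this
    have h4 := h3.mul_isBigO (G'.isBigO_comp (fun q => q - x) (𝓝 x)).norm_right
    simpa using h4
  refine (h1.add h2).congr_left fun q => ?_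
  simp [h0]
  ring

lemma zero_cond {D1 D2 : ℝ × ℝ → ℝ} {a0 : ℝ × ℝ → ℝ × ℝ} {c k : ℝ × ℝ → ℝ}
    (hc : ContinuousAt c 0) (hk : ContinuousAt k 0) (hc0 : c 0 ≠ 0) (hk0 : k 0 ≠ 0)
    (ha : DifferentiableAt ℝ a0 0) (ha0 : a0 0 = 0)
    (hs : Function.Surjective (fderiv ℝ a0 0))
    (hD2 : DifferentiableAt ℝ D2 0)
    (h : ∀ᶠ u in 𝓝 0, c u * D1 u = k u * D2 (a0 u)) :
    (D1 0 = 0 ∧ fderiv ℝ D1 0 ≠ 0) ↔ (D2 0 = 0 ∧ fderiv ℝ D2 0 ≠ 0) := by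
  have h00 : c 0 * D1 0 = k 0 * D2 0 := by simpa [ha0] using h.self_of_nhds
  have hz : D1 0 = 0 ↔ D2 0 = 0 := by
    constructor
    · intro h1
      rw [h1, mul_zero] at h00
      exact (mul_eq_zero.1 h00.symm).resolve_left hk0
    · intro h1
      rw [h1, mul_zero] at h00
      exact (mul_eq_zero.1 h00).resolve_left hc0
  rw [hz]
  refine and_congr_right fun hD => ?_
  have hκ : ContinuousAt (fun u => k u / c u) 0 := hk.div hc hc0
  have hG : HasFDerivAt (fun u => D2 (a0 u)) ((fderiv ℝ D2 0).comp (fderiv ℝ a0 0)) 0 := by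
    have h1 : HasFDerivAt D2 (fderiv ℝ D2 0) (a0 0) := by rw [ha0]; exact hD2.hasFDerivAt
    exact h1.comp 0 ha.hasFDerivAt
  have h1 := hasFDerivAt_mul_vanish hκ hG (by rw [ha0, hD])
  have h2 : HasFDerivAt D1 ((k 0 / c 0) • ((fderiv ℝ D2 0).comp (fderiv ℝ a0 0))) 0 := by
    refine h1.congr_of_eventuallyEq ?_
    filter_upwards [h, hc.eventually_ne hc0] with u hu hcu
    field_simp
    linarith
  rw [h2.fderiv, not_iff_not]
  constructor
  · intro h3
    rw [smul_eq_zero] at h3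
    have h3 := h3.resolve_left (div_ne_zero hk0 hc0)
    refine ContinuousLinearMap.ext fun w => ?_
    obtain ⟨w', hw⟩ := hs w
    have := DFunLike.congr_fun h3 w'
    simpa [hw] using this
  · intro h3
    rw [h3]; simp

lemma contDiffAt_det4 {X : Type*} [NormedAddCommGroup X] [NormedSpace ℝ X] {n : WithTop ℕ∞}
    {a b c d : X → E4} {x : X} (ha : ContDiffAt ℝ n a x) (hb : ContDiffAt ℝ n b x)
    (hc : ContDiffAt ℝ n c x) (hd : ContDiffAt ℝ n d x) :
    ContDiffAt ℝ n (fun q => det4 (a q) (b q) (c q) (d q)) x := by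
  have ha := contDiffAt_pi.1 ha
  have hb := contDiffAt_pi.1 hb
  have hc := contDiffAt_pi.1 hc
  have hd := contDiffAt_pi.1 hd
  simp only [det4_expand]
  have m := fun (f g h k : X → E4) (i j l o : Fin 4) (hf : ∀ i, ContDiffAt ℝ n (fun x => f x i) x)
    (hg : ∀ i, ContDiffAt ℝ n (fun x => g x i) x) (hh : ∀ i, ContDiffAt ℝ n (fun x => h x i) x)
    (hk : ∀ i, ContDiffAt ℝ n (fun x => k x i) x) =>
    (((hf i).mul (hg j)).sub ((hf j).mul (hg i))).mul (((hh l).mul (hk o)).sub ((hh o).mul (hk l)))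
  exact (((((m a b c d 0 1 2 3 ha hb hc hd).sub (m a b c d 0 2 1 3 ha hb hc hd)).add
    (m a b c d 0 3 1 2 ha hb hc hd)).add (m a b c d 1 2 0 3 ha hb hc hd)).sub
    (m a b c d 1 3 0 2 ha hb hc hd)).add (m a b c d 2 3 0 1 ha hb hc hd)

/-- The reduced invariant of `(u,x) ↦ F0 u + x² g(u,x)`. -/
def Delta (F0 : ℝ × ℝ → E4) (g : (ℝ × ℝ) × ℝ → E4) (u : ℝ × ℝ) : ℝ :=
  det4 (fderiv ℝ F0 u (1, 0)) (fderiv ℝ F0 u (0, 1)) (g (u, 0)) (fderiv ℝ g (u, 0) (0, 1))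

lemma key_inv {F0 : ℝ × ℝ → E4} (hF0 : ContDiff ℝ (⊤ : ℕ∞) F0)
    {g : (ℝ × ℝ) × ℝ → E4} (hg : ContDiff ℝ (⊤ : ℕ∞) g) {Φ : E4 → E4}
    (hΦ : ContDiffAt ℝ (⊤ : ℕ∞) Φ (F0 0)) (hΦb : Function.Bijective (fderiv ℝ Φ (F0 0)))
    {a : (ℝ × ℝ) × ℝ → ℝ × ℝ} {y : (ℝ × ℝ) × ℝ → ℝ}
    (ha : ContDiffAt ℝ (⊤ : ℕ∞) a 0) (hy : ContDiffAt ℝ (⊤ : ℕ∞) y 0) (ha0 : a 0 = 0)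
    (hinj : Function.Injective (fderiv ℝ (fun q => (a q, y q)) 0))
    {e : (ℝ × ℝ) × ℝ → ℝ} (he : ContDiff ℝ (⊤ : ℕ∞) e)
    (heq : ∀ᶠ q in 𝓝 (0 : (ℝ × ℝ) × ℝ), Φ (F0 q.1 + q.2 ^ 2 • g q) =
      ![(a q).1, (a q).2, y q ^ 2, y q ^ 2 * e (a q, y q)])
    (hy0 : ∀ᶠ u in 𝓝 (0 : ℝ × ℝ), y (u, 0) = 0) :
    (Delta F0 g 0 = 0 ∧ fderiv ℝ (Delta F0 g) 0 ≠ 0) ↔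
      (fderiv ℝ e (0, 0) (0, 1) = 0 ∧
        fderiv ℝ (fun v : ℝ × ℝ => fderiv ℝ e (v, 0) (0, 1)) 0 ≠ 0) := by
  have hι : Tendsto (fun u : ℝ × ℝ => (u, (0:ℝ))) (𝓝 0) (𝓝 0) := by
    have : Continuous (fun u : ℝ × ℝ => (u, (0:ℝ))) := by fun_prop
    exact this.tendsto 0
  have hdy : ∀ᶠ u in 𝓝 (0 : ℝ × ℝ), DifferentiableAt ℝ y (u, 0) := by
    have := ((hy.of_le (m := 1) (by exact_mod_cast le_top)).eventually (by simp))
    filter_upwards [hι.eventually this] with u hu using hu.differentiableAt (by simp)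
  have hda : ∀ᶠ u in 𝓝 (0 : ℝ × ℝ), DifferentiableAt ℝ a (u, 0) := by
    have := ((ha.of_le (m := 1) (by exact_mod_cast le_top)).eventually (by simp))
    filter_upwards [hι.eventually this] with u hu using hu.differentiableAt (by simp)
  have hΦ2 : ∀ᶠ u in 𝓝 (0 : ℝ × ℝ), ContDiffAt ℝ 2 Φ (F0 u) :=
    (hF0.continuous.tendsto 0).eventually
      ((contDiffAt_infty.1 hΦ 2).eventually (by simp))
  have heq2 : ∀ᶠ u in 𝓝 (0 : ℝ × ℝ), ∀ᶠ x in 𝓝 (0 : ℝ), Φ (F0 u + x ^ 2 • g (u, x)) =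
      ![(a (u, x)).1, (a (u, x)).2, y (u, x) ^ 2, y (u, x) ^ 2 * e (a (u, x), y (u, x))] :=
    Eventually.curry_nhds (x := (0 : ℝ × ℝ)) (y := (0 : ℝ)) heq
  have hcurve : ∀ᶠ u in 𝓝 (0 : ℝ × ℝ), HasDerivAt (fun x => a (u, x)) 0 0 ∧
    (fderiv ℝ Φ (F0 u) (g (u, 0))) 2 * (fderiv ℝ Φ (F0 u) (fderiv ℝ g (u, 0) (0, 1))) 3
     - (fderiv ℝ Φ (F0 u) (g (u, 0))) 3 * (fderiv ℝ Φ (F0 u) (fderiv ℝ g (u, 0) (0, 1))) 2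
      = (fderiv ℝ y (u, 0) (0, 1)) ^ 5 * fderiv ℝ e (a (u, 0), 0) (0, 1) := by
    filter_upwards [hdy, hΦ2, heq2, hy0] with u h1 h2 h3 h4
    have hl : HasDerivAt (fun x : ℝ => (u, x)) ((0 : ℝ × ℝ), (1:ℝ)) 0 :=
      (hasDerivAt_const (0:ℝ) u).prodMk (hasDerivAt_id (0:ℝ))
    have hv : HasDerivAt (fun x : ℝ => g (u, x)) (fderiv ℝ g (u, 0) (0, 1)) 0 :=
      HasFDerivAt.comp_hasDerivAt (0:ℝ) (hg.differentiable (by simp) (u, 0)).hasFDerivAt hl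
    have hyy : HasDerivAt (fun x : ℝ => y (u, x)) (fderiv ℝ y (u, 0) (0, 1)) 0 :=
      HasFDerivAt.comp_hasDerivAt (0:ℝ) h1.hasFDerivAt hl
    exact curve_key h2 hv hyy h4 (he.differentiable (by simp) _) h3
  have htan : ∀ᶠ u in 𝓝 (0 : ℝ × ℝ), ∀ w : ℝ × ℝ, fderiv ℝ Φ (F0 u) (fderiv ℝ F0 u w) =
      ![(fderiv ℝ a (u, 0) (w, 0)).1, (fderiv ℝ a (u, 0) (w, 0)).2, 0, 0] := by
    have hE : ∀ᶠ u in 𝓝 (0 : ℝ × ℝ), Φ (F0 u) = ![(a (u, 0)).1, (a (u, 0)).2, 0, 0] := by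
      filter_upwards [heq2, hy0] with u h1 h2
      simpa [h2] using h1.self_of_nhds
    filter_upwards [hE.eventually_nhds, hda, hΦ2] with u h1 h2 h3 w
    have d1 : HasFDerivAt (fun u => Φ (F0 u)) ((fderiv ℝ Φ (F0 u)).comp (fderiv ℝ F0 u)) u :=
      (h3.differentiableAt (by simp)).hasFDerivAt.comp u (hF0.differentiable (by simp) u).hasFDerivAt
    have d2 : HasFDerivAt (fun u => a (u, 0)) ((fderiv ℝ a (u, 0)).comp (ContinuousLinearMap.inl ℝ (ℝ × ℝ) ℝ)) u :=
      HasFDerivAt.comp u h2.hasFDerivAt (hasFDerivAt_prodMk_left u (0:ℝ))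
    have hh : (fun u => ![(a (u, 0)).1, (a (u, 0)).2, 0, 0]) =ᶠ[𝓝 u] fun u => Φ (F0 u) :=
      h1.mono fun _ h => h.symm
    have d1' := fun i => hasFDerivAt_pi'.1 (d1.congr_of_eventuallyEq hh) i
    ext i
    fin_cases i
    · have := (d1' 0).unique d2.fst
      simpa using DFunLike.congr_fun this w
    · have := (d1' 1).unique d2.snd
      simpa using DFunLike.congr_fun this w
    · have := (d1' 2).unique (hasFDerivAt_const (0:ℝ) u)
      simpa using DFunLike.congr_fun this w
    · have := (d1' 3).unique (hasFDerivAt_const (0:ℝ) u)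
      simpa using DFunLike.congr_fun this w
  let J : ℝ × ℝ → ℝ := fun u =>
    (fderiv ℝ a (u, 0) ((1, 0), 0)).1 * (fderiv ℝ a (u, 0) ((0, 1), 0)).2
    - (fderiv ℝ a (u, 0) ((1, 0), 0)).2 * (fderiv ℝ a (u, 0) ((0, 1), 0)).1
  let b : ℝ × ℝ → ℝ := fun u => fderiv ℝ y (u, 0) (0, 1)
  have hcy : ContinuousAt (fun u : ℝ × ℝ => fderiv ℝ y (u, 0)) 0 := by
    have h1 : ContinuousAt (fderiv ℝ y) ((0 : ℝ × ℝ), (0:ℝ)) :=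
      (hy.fderiv_right (m := 0) (by simp)).continuousAt
    exact ContinuousAt.comp (f := fun u : ℝ × ℝ => (u, (0:ℝ))) h1 (by fun_prop)
  have hca : ContinuousAt (fun u : ℝ × ℝ => fderiv ℝ a (u, 0)) 0 := by
    have h1 : ContinuousAt (fderiv ℝ a) ((0 : ℝ × ℝ), (0:ℝ)) :=
      (ha.fderiv_right (m := 0) (by simp)).continuousAt
    exact ContinuousAt.comp (f := fun u : ℝ × ℝ => (u, (0:ℝ))) h1 (by fun_prop)
  have hcΦ : ContinuousAt (fun u : ℝ × ℝ => fderiv ℝ Φ (F0 u)) 0 := by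
    have h1 : ContinuousAt (fderiv ℝ Φ) (F0 0) :=
      (hΦ.fderiv_right (m := 0) (by simp)).continuousAt
    exact ContinuousAt.comp (f := F0) h1 hF0.continuous.continuousAt
  have hay : fderiv ℝ (fun q => (a q, y q)) 0 = (fderiv ℝ a 0).prod (fderiv ℝ y 0) :=
    (HasFDerivAt.prodMk (ha.differentiableAt (by simp)).hasFDerivAt
      (hy.differentiableAt (by simp)).hasFDerivAt).fderiv
  rw [hay] at hinj
  have hinj0 : ∀ w, fderiv ℝ a 0 w = 0 → fderiv ℝ y 0 w = 0 → w = 0 := by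
    intro w h1 h2
    apply hinj
    simp [h1, h2]
  have hyu : ∀ w : ℝ × ℝ, fderiv ℝ y 0 (w, 0) = 0 := by
    have d2 : HasFDerivAt (fun u : ℝ × ℝ => y (u, 0)) ((fderiv ℝ y (0, 0)).comp (ContinuousLinearMap.inl ℝ (ℝ × ℝ) ℝ)) 0 :=
      HasFDerivAt.comp 0 hdy.self_of_nhds.hasFDerivAt (hasFDerivAt_prodMk_left 0 (0:ℝ))
    have := d2.unique ((hasFDerivAt_const (0:ℝ) (0 : ℝ × ℝ)).congr_of_eventuallyEq hy0)
    intro w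
    exact DFunLike.congr_fun this w
  have hax : fderiv ℝ a 0 (0, 1) = 0 := by
    have hl : HasDerivAt (fun x : ℝ => ((0 : ℝ × ℝ), x)) ((0 : ℝ × ℝ), (1:ℝ)) 0 :=
      (hasDerivAt_const (0:ℝ) _).prodMk (hasDerivAt_id (0:ℝ))
    have h1 := HasFDerivAt.comp_hasDerivAt (0:ℝ) hda.self_of_nhds.hasFDerivAt hl
    exact h1.unique hcurve.self_of_nhds.1
  have hb0 : b 0 ≠ 0 := by
    intro h
    have := hinj0 (0, 1) hax h
    simp at this
  have hAinj : ∀ w : ℝ × ℝ, fderiv ℝ a 0 (w, 0) = 0 → w = 0 := by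
    intro w hw
    have := hinj0 _ hw (hyu w)
    simpa using this
  have hAlin : ∀ s t : ℝ, fderiv ℝ a 0 ((s, t), 0) =
      s • fderiv ℝ a 0 ((1, 0), 0) + t • fderiv ℝ a 0 ((0, 1), 0) := by
    intro s t
    rw [← map_smul, ← map_smul, ← map_add]; simp
  have hJ0 : J 0 ≠ 0 := by
    intro h
    have h : (fderiv ℝ a 0 ((1, 0), 0)).1 * (fderiv ℝ a 0 ((0, 1), 0)).2
      - (fderiv ℝ a 0 ((1, 0), 0)).2 * (fderiv ℝ a 0 ((0, 1), 0)).1 = 0 := h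
    have h1 := hAinj ((fderiv ℝ a 0 ((0, 1), 0)).2, -(fderiv ℝ a 0 ((1, 0), 0)).2) (by
      rw [hAlin]; ext <;> simp <;> linarith)
    have h2 := hAinj ((fderiv ℝ a 0 ((0, 1), 0)).1, -(fderiv ℝ a 0 ((1, 0), 0)).1) (by
      rw [hAlin]; ext <;> simp <;> linarith)
    simp at h1 h2
    have h3 := hAinj (1, 0) (by ext <;> simp [h1, h2])
    simp at h3
  refine zero_cond (D2 := fun v : ℝ × ℝ => fderiv ℝ e (v, 0) (0, 1)) (a0 := fun u => a (u, 0))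
    (c := fun u => (fderiv ℝ Φ (F0 u)).det) (k := fun u => J u * b u ^ 5)
    ?_ ?_ ?_ ?_ ?_ ?_ ?_ ?_ ?_
  · exact ContinuousAt.comp (f := fun u : ℝ × ℝ => fderiv ℝ Φ (F0 u))
      ContinuousLinearMap.continuous_det.continuousAt hcΦ
  · refine ContinuousAt.mul ?_ ?_
    · have h1 := hca.clm_apply (continuousAt_const (y := (((1:ℝ), (0:ℝ)), (0:ℝ))))
      have h2 := hca.clm_apply (continuousAt_const (y := (((0:ℝ), (1:ℝ)), (0:ℝ))))
      exact (h1.fst.mul h2.snd).sub (h1.snd.mul h2.fst)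
    · exact (hcy.clm_apply continuousAt_const).pow 5
  · intro h
    have h2 : IsUnit (LinearMap.det (fderiv ℝ Φ (F0 0) : E4 →ₗ[ℝ] E4)) := by
      have := (LinearEquiv.ofBijective (fderiv ℝ Φ (F0 0) : E4 →ₗ[ℝ] E4) hΦb).isUnit_det'
      exact this
    exact h2.ne_zero h
  · exact mul_ne_zero hJ0 (pow_ne_zero 5 hb0)
  · exact DifferentiableAt.comp (f := fun u : ℝ × ℝ => (u, (0:ℝ))) 0 hda.self_of_nhds (by fun_prop)
  · exact ha0
  · have d2 : HasFDerivAt (fun u : ℝ × ℝ => a (u, 0)) ((fderiv ℝ a (0, 0)).comp (ContinuousLinearMap.inl ℝ (ℝ × ℝ) ℝ)) 0 :=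
      HasFDerivAt.comp 0 hda.self_of_nhds.hasFDerivAt (hasFDerivAt_prodMk_left 0 (0:ℝ))
    rw [d2.fderiv]
    refine (LinearMap.injective_iff_surjective (f := (((fderiv ℝ a (0, 0)).comp (ContinuousLinearMap.inl ℝ (ℝ × ℝ) ℝ)) : (ℝ × ℝ) →ₗ[ℝ] (ℝ × ℝ)))).1 ?_
    rw [injective_iff_map_eq_zero]
    intro w hw
    exact hAinj w hw
  · have h1 : ContDiff ℝ (⊤ : ℕ∞) (fun v : ℝ × ℝ => fderiv ℝ e (v, 0) (0, 1)) := by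
      have := (he.fderiv_right (m := (⊤ : ℕ∞)) (by simp))
      exact ContDiff.clm_apply (this.comp (by fun_prop)) contDiff_const
    exact h1.differentiable (by simp) 0
  · filter_upwards [hcurve, htan] with u h1 h2
    have h3 := det4_map (fderiv ℝ Φ (F0 u)) (fderiv ℝ F0 u (1, 0)) (fderiv ℝ F0 u (0, 1)) (g (u, 0))
      (fderiv ℝ g (u, 0) (0, 1))
    rw [h2, h2, det4_expand] at h3
    simp at h3
    rw [h1.2] at h3
    simp only [ContinuousLinearMap.det, Delta, J, b]
    rw [← h3]
    ring

lemma hadamard_twice {F : (ℝ × ℝ) × ℝ → E4} (hF : ContDiff ℝ (⊤ : ℕ∞) F)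
    (h0 : ∀ᶠ u in 𝓝 (0 : ℝ × ℝ), fderiv ℝ F (u, 0) (0, 1) = 0) :
    ∃ g : (ℝ × ℝ) × ℝ → E4, ContDiff ℝ (⊤ : ℕ∞) g ∧
      ∀ᶠ u in 𝓝 (0 : ℝ × ℝ), ∀ x : ℝ, F (u, x) = F (u, 0) + x ^ 2 • g (u, x) := by
  obtain ⟨h, hh, hh1⟩ := hadamard hF
  obtain ⟨g, hg, hg1⟩ := hadamard hh
  refine ⟨g, hg, ?_⟩
  filter_upwards [h0] with u hu x
  have hl : HasDerivAt (fun x : ℝ => (u, x)) ((0 : ℝ × ℝ), (1:ℝ)) 0 :=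
    (hasDerivAt_const (0:ℝ) u).prodMk (hasDerivAt_id (0:ℝ))
  have d1 : HasDerivAt (fun x : ℝ => F (u, x)) (fderiv ℝ F (u, 0) (0, 1)) 0 :=
    HasFDerivAt.comp_hasDerivAt (0:ℝ) (hF.differentiable (by simp) (u, 0)).hasFDerivAt hl
  have d2 : HasDerivAt (fun x : ℝ => h (u, x)) (fderiv ℝ h (u, 0) (0, 1)) 0 :=
    HasFDerivAt.comp_hasDerivAt (0:ℝ) (hh.differentiable (by simp) (u, 0)).hasFDerivAt hl
  have d3 : HasDerivAt (fun x : ℝ => F (u, x)) (h (u, 0)) 0 := by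
    have := ((hasDerivAt_id (0:ℝ)).smul d2).const_add (F (u, 0))
    simp only [id, zero_smul, one_smul, zero_add] at this
    refine this.congr_of_eventuallyEq (Eventually.of_forall fun x => hh1 u x)
  have h00 : h (u, 0) = 0 := by rw [← hu]; exact d3.unique d1
  rw [hh1, hg1 u x, h00, zero_add, smul_smul, pow_two]

lemma extend_germ {E F : Type} [NormedAddCommGroup E] [NormedSpace ℝ E] [FiniteDimensional ℝ E]
    [NormedAddCommGroup F] [NormedSpace ℝ F] {h : E → F} {p : E}
    (hh : ∀ᶠ q in 𝓝 p, ContDiffAt ℝ (⊤ : ℕ∞) h q) :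
    ∃ k : E → F, ContDiff ℝ (⊤ : ℕ∞) k ∧ k =ᶠ[𝓝 p] h := by
  obtain ⟨r, hr, hball⟩ := Metric.mem_nhds_iff.1 hh
  let b : ContDiffBump p := ⟨r / 4, r / 2, by positivity, by linarith⟩
  refine ⟨fun q => b q • h q, ?_, ?_⟩
  · rw [contDiff_iff_contDiffAt]
    intro q
    by_cases hq : q ∈ Metric.ball p r
    · exact b.contDiffAt.smul (hball hq)
    · have : (fun q => b q • h q) =ᶠ[𝓝 q] fun _ => 0 := by
        have h1 : (Metric.closedBall p (r / 2))ᶜ ∈ 𝓝 q := by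
          refine Metric.isClosed_closedBall.isOpen_compl.mem_nhds ?_
          simp at hq ⊢
          linarith
        filter_upwards [h1] with z hz
        have : b z = 0 := b.zero_of_le_dist (by simp at hz; exact hz.le)
        simp [this]
      exact contDiffAt_const.congr_of_eventuallyEq this
  · filter_upwards [b.eventuallyEq_one] with q hq
    simp [hq]

/-- Local inverse. -/
lemma local_inv {E F : Type} [NormedAddCommGroup E] [NormedSpace ℝ E] [FiniteDimensional ℝ E]
    [NormedAddCommGroup F] [NormedSpace ℝ F] [FiniteDimensional ℝ F] {T : E → F} {p : E}
    (hT : ∀ᶠ q in 𝓝 p, ContDiffAt ℝ (⊤ : ℕ∞) T q)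
    (hb : Function.Bijective (fderiv ℝ T p)) :
    ∃ S : F → E, S (T p) = p ∧ (∀ᶠ w in 𝓝 (T p), ContDiffAt ℝ (⊤ : ℕ∞) S w) ∧
      (∀ᶠ q in 𝓝 p, S (T q) = q) ∧ (∀ᶠ w in 𝓝 (T p), T (S w) = w) ∧
      (∀ w, fderiv ℝ S (T p) (fderiv ℝ T p w) = w) ∧ Function.Bijective (fderiv ℝ S (T p)) := by
  have hTp := hT.self_of_nhds
  let Le : E ≃L[ℝ] F := (LinearEquiv.ofBijective (fderiv ℝ T p : E →ₗ[ℝ] F) hb).toContinuousLinearEquiv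
  have hLe : (Le : E →L[ℝ] F) = fderiv ℝ T p := by ext; rfl
  have hd : HasFDerivAt T (Le : E →L[ℝ] F) p := by
    rw [hLe]; exact (hTp.differentiableAt (by simp)).hasFDerivAt
  let Q := hTp.toOpenPartialHomeomorph T hd (by simp)
  have hQ : (Q : E → F) = T := hTp.toOpenPartialHomeomorph_coe hd (by simp)
  have hp : p ∈ Q.source := hTp.mem_toOpenPartialHomeomorph_source hd (by simp)
  have hTpt : T p ∈ Q.target := by
    have := Q.map_source hp
    rwa [hQ] at this
  have hSp : Q.symm (T p) = p := by
    have := Q.left_inv hp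
    rwa [hQ] at this
  have hSc : Tendsto Q.symm (𝓝 (T p)) (𝓝 p) := by
    have := Q.continuousAt_symm hTpt
    rw [ContinuousAt, hSp] at this; exact this
  have hL : ∀ᶠ q in 𝓝 p, Q.symm (T q) = q := by
    filter_upwards [Q.open_source.mem_nhds hp] with q hq
    have := Q.left_inv hq
    rwa [hQ] at this
  have hR : ∀ᶠ w in 𝓝 (T p), T (Q.symm w) = w := by
    filter_upwards [Q.open_target.mem_nhds hTpt] with w hw
    have := Q.right_inv hw
    rwa [hQ] at this
  have hinvd : ∀ᶠ q in 𝓝 p, ∃ L' : E ≃L[ℝ] F, HasFDerivAt T (L' : E →L[ℝ] F) q := by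
    have h1 : ContinuousAt (fderiv ℝ T) p := (hTp.fderiv_right (m := 0) (by simp)).continuousAt
    have h2 : ∀ᶠ q in 𝓝 p, fderiv ℝ T q ∈ Set.range (ContinuousLinearEquiv.toContinuousLinearMap : (E ≃L[ℝ] F) → E →L[ℝ] F) := by
      apply h1
      rw [← hLe]
      exact ContinuousLinearEquiv.nhds Le
    filter_upwards [h2, hT] with q h2 h3
    obtain ⟨L', hL'⟩ := h2
    refine ⟨L', ?_⟩
    rw [hL']; exact (h3.differentiableAt (by simp)).hasFDerivAt
  have hS : ∀ᶠ w in 𝓝 (T p), ContDiffAt ℝ (⊤ : ℕ∞) Q.symm w := by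
    filter_upwards [hSc.eventually hT, hSc.eventually hinvd, Q.open_target.mem_nhds hTpt] with w h1 h2 h3
    obtain ⟨L', hL'⟩ := h2
    exact Q.contDiffAt_symm h3 (f₀' := L') (by rw [hQ]; exact hL') (by rw [hQ]; exact h1)
  have hSd : ∀ w, fderiv ℝ Q.symm (T p) (fderiv ℝ T p w) = w := by
    intro w
    have h1 := (hS.self_of_nhds.differentiableAt (by simp)).hasFDerivAt.comp p
      (hTp.differentiableAt (by simp)).hasFDerivAt
    have h2 := h1.unique ((hasFDerivAt_id p).congr_of_eventuallyEq hL)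
    exact DFunLike.congr_fun h2 w
  refine ⟨Q.symm, hSp, hS, hL, hR, hSd, ?_, ?_⟩
  · intro a b hab
    obtain ⟨a, rfl⟩ := hb.2 a
    obtain ⟨b, rfl⟩ := hb.2 b
    rw [hSd, hSd] at hab
    rw [hab]
  · intro w
    exact ⟨_, hSd w⟩

lemma bij_of_inj {E : Type*} [NormedAddCommGroup E] [NormedSpace ℝ E] [FiniteDimensional ℝ E]
    (L : E →L[ℝ] E) (h : ∀ w, L w = 0 → w = 0) : Function.Bijective L := by
  have h1 : Function.Injective (L : E →ₗ[ℝ] E) := (injective_iff_map_eq_zero _).2 h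
  exact ⟨h1, LinearMap.injective_iff_surjective.1 h1⟩

lemma det4_indep {a b c d : E4} (h : det4 a b c d ≠ 0) (w : E4)
    (hw : w 0 • a + w 1 • b + w 2 • c + w 3 • d = 0) : w = 0 := by
  refine Matrix.eq_zero_of_vecMul_eq_zero (M := Matrix.of ![a, b, c, d]) h ?_
  rw [← hw]
  ext i
  simp [Matrix.vecMul, dotProduct, Fin.sum_univ_four]

lemma suff1 {F0 : ℝ × ℝ → E4} (hF0 : ContDiff ℝ (⊤ : ℕ∞) F0)
    {g : (ℝ × ℝ) × ℝ → E4} (hg : ContDiff ℝ (⊤ : ℕ∞) g) {ν0 : E4}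
    (hd : det4 (fderiv ℝ F0 0 (1, 0)) (fderiv ℝ F0 0 (0, 1)) (g 0) ν0 ≠ 0) :
    ∃ (S : E4 → E4) (a : (ℝ × ℝ) × ℝ → ℝ × ℝ) (y e : (ℝ × ℝ) × ℝ → ℝ),
      ContDiffAt ℝ (⊤ : ℕ∞) S (F0 0) ∧ Function.Bijective (fderiv ℝ S (F0 0)) ∧ S (F0 0) = 0 ∧
      ContDiffAt ℝ (⊤ : ℕ∞) a 0 ∧ ContDiffAt ℝ (⊤ : ℕ∞) y 0 ∧ a 0 = 0 ∧
      (∀ u, y (u, 0) = 0) ∧ HasFDerivAt (fun q => (a q, y q)) (ContinuousLinearMap.id ℝ _) 0 ∧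
      ContDiff ℝ (⊤ : ℕ∞) e ∧
      ∀ᶠ q in 𝓝 (0 : (ℝ × ℝ) × ℝ), S (F0 q.1 + q.2 ^ 2 • g q) =
        ![(a q).1, (a q).2, y q ^ 2, y q ^ 2 * e (a q, y q)] := by
  -- the chart Θ
  let Θ : E4 → E4 := fun v => F0 (v 0, v 1) + v 2 • g 0 + v 3 • ν0
  have hΘ : ContDiff ℝ (⊤ : ℕ∞) Θ := by
    have : ∀ i : Fin 4, ContDiff ℝ (⊤ : ℕ∞) (fun v : E4 => v i) := fun i => contDiff_apply ℝ ℝ i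
    exact ((hF0.comp ((this 0).prodMk (this 1))).add ((this 2).smul contDiff_const)).add
      ((this 3).smul contDiff_const)
  have hΘ0 : Θ 0 = F0 0 := by simp [Θ]; rfl
  have hΘd : ∀ w, fderiv ℝ Θ 0 w = w 0 • fderiv ℝ F0 0 (1, 0) + w 1 • fderiv ℝ F0 0 (0, 1)
      + w 2 • g 0 + w 3 • ν0 := by
    intro w
    let pr : Fin 4 → (E4 →L[ℝ] ℝ) := fun i => ContinuousLinearMap.proj i
    have hp : ∀ i, HasFDerivAt (fun v : E4 => v i) (pr i) 0 := fun i => (pr i).hasFDerivAt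
    have h1 : HasFDerivAt (fun v : E4 => F0 (v 0, v 1)) ((fderiv ℝ F0 0).comp ((pr 0).prod (pr 1))) 0 :=
      HasFDerivAt.comp (g := F0) (f := fun v : E4 => (v 0, v 1)) 0 (hF0.differentiable (by simp) 0).hasFDerivAt ((hp 0).prodMk (hp 1))
    have h2 := (h1.add ((hp 2).smul_const (g 0))).add ((hp 3).smul_const ν0)
    have h3 : fderiv ℝ Θ 0 = _ := h2.fderiv
    rw [h3]
    have h4 : (w 0, w 1) = w 0 • ((1:ℝ), (0:ℝ)) + w 1 • ((0:ℝ), (1:ℝ)) := by simp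
    simp only [add_apply, ContinuousLinearMap.comp_apply,
      ContinuousLinearMap.prod_apply, pr, ContinuousLinearMap.proj_apply,
      ContinuousLinearMap.smulRight_apply]
    rw [h4, map_add, map_smul, map_smul]
  have hΘb : Function.Bijective (fderiv ℝ Θ 0) := by
    refine bij_of_inj _ fun w hw => det4_indep hd w ?_
    rw [← hΘd, hw]
  obtain ⟨S, hS0, hSs, hSL, hSR, hSd, hSb⟩ :=
    local_inv (p := (0 : E4)) (Eventually.of_forall fun q => hΘ.contDiffAt) hΘb
  rw [hΘ0] at hS0 hSs hSR hSd hSb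
  -- f2
  let f1 : (ℝ × ℝ) × ℝ → E4 := fun q => F0 q.1 + q.2 ^ 2 • g q
  have hf1 : ContDiff ℝ (⊤ : ℕ∞) f1 :=
    (hF0.comp contDiff_fst).add ((contDiff_snd.pow 2).smul hg)
  have hf10 : f1 0 = F0 0 := by simp [f1]
  have hf1t : Tendsto f1 (𝓝 0) (𝓝 (F0 0)) := by
    rw [← hf10]; exact hf1.continuous.tendsto 0
  obtain ⟨f2, hf2, hf2e⟩ := extend_germ (h := fun q => S (f1 q)) (p := (0 : (ℝ × ℝ) × ℝ)) (by
    filter_upwards [hf1t.eventually hSs] with q hq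
    exact hq.comp q hf1.contDiffAt)
  have hι : Tendsto (fun u : ℝ × ℝ => (u, (0:ℝ))) (𝓝 0) (𝓝 0) := by
    have : Continuous (fun u : ℝ × ℝ => (u, (0:ℝ))) := by fun_prop
    exact this.tendsto 0
  have hv : ∀ u, HasDerivAt (fun x : ℝ => g (u, x)) (fderiv ℝ g (u, 0) (0, 1)) 0 := fun u =>
    HasFDerivAt.comp_hasDerivAt (0:ℝ) (hg.differentiable (by simp) (u, 0)).hasFDerivAt
      ((hasDerivAt_const (0:ℝ) u).prodMk (hasDerivAt_id (0:ℝ)))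
  have hf2u : ∀ᶠ u in 𝓝 (0 : ℝ × ℝ), ∀ᶠ x in 𝓝 (0:ℝ), f2 (u, x) = S (f1 (u, x)) :=
    Eventually.curry_nhds (x := (0 : ℝ × ℝ)) (y := (0 : ℝ)) hf2e
  have hf20 : ∀ᶠ u in 𝓝 (0 : ℝ × ℝ), f2 (u, 0) = ![u.1, u.2, 0, 0] := by
    have ht : Tendsto (fun u : ℝ × ℝ => (![u.1, u.2, 0, 0] : E4)) (𝓝 0) (𝓝 0) := by
      have : Continuous (fun u : ℝ × ℝ => (![u.1, u.2, 0, 0] : E4)) := by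
        refine continuous_pi fun i => ?_
        fin_cases i <;> simp <;> fun_prop
      convert this.tendsto 0
      ext i; fin_cases i <;> rfl
    filter_upwards [hf2u, ht.eventually hSL] with u h1 h2
    rw [h1.self_of_nhds, ← h2]
    simp [f1, Θ]
  have hf2x : ∀ᶠ u in 𝓝 (0 : ℝ × ℝ), fderiv ℝ f2 (u, 0) (0, 1) = 0 := by
    filter_upwards [hf2u, (hF0.continuous.tendsto 0).eventually hSs] with u h1 h2
    obtain ⟨r, hr0, hr1, hr2⟩ := curve_expand (contDiffAt_infty.1 h2 2) (hv u)
    have d1 : HasDerivAt (fun x : ℝ => f2 (u, x)) (fderiv ℝ f2 (u, 0) (0, 1)) 0 :=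
      HasFDerivAt.comp_hasDerivAt (0:ℝ) (hf2.differentiable (by simp) (u, 0)).hasFDerivAt
        ((hasDerivAt_const (0:ℝ) u).prodMk (hasDerivAt_id (0:ℝ)))
    have d2 : HasDerivAt (fun x : ℝ => S (F0 u) + x ^ 2 • r x) 0 0 := by
      have := (((hasDerivAt_id (0:ℝ)).pow 2).smul hr1).const_add (S (F0 u))
      simpa using this
    refine d1.unique (d2.congr_of_eventuallyEq ?_)
    filter_upwards [h1] with x hx
    rw [hx, ← hr2]
  obtain ⟨k, hk, hk1⟩ := hadamard_twice hf2 hf2x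
  have hk0 : k 0 = ![0, 0, 1, 0] := by
    obtain ⟨r, hr0, hr1, hr2⟩ := curve_expand (contDiffAt_infty.1 hSs.self_of_nhds 2) (hv 0)
    have h1 : Tendsto (fun x : ℝ => k (0, x)) (𝓝[≠] 0) (𝓝 (k 0)) := by
      have : Continuous (fun x : ℝ => k (0, x)) := hk.continuous.comp (by fun_prop)
      exact (this.tendsto 0).mono_left nhdsWithin_le_nhds
    have h2 : Tendsto r (𝓝[≠] 0) (𝓝 (r 0)) := hr1.continuousAt.tendsto.mono_left nhdsWithin_le_nhds
    have h3 : k 0 = r 0 := by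
      refine tendsto_nhds_unique (h1.congr' ?_) h2
      filter_upwards [self_mem_nhdsWithin, hf2u.self_of_nhds.filter_mono nhdsWithin_le_nhds] with x h0 hx
      have h0 : x ^ 2 ≠ 0 := pow_ne_zero 2 h0
      have h4 := hk1.self_of_nhds x
      have h5 : f2 (0, 0) = S (F0 0) := by
        have := hf2u.self_of_nhds.self_of_nhds
        rw [this]; exact congrArg S hf10
      rw [hx, h5] at h4
      have h6 := hr2 x
      have h7 : x ^ 2 • k (0, x) = x ^ 2 • r x := by
        have : f1 (0, x) = F0 0 + x ^ 2 • g (0, x) := rfl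
        rw [this, h6] at h4
        exact (add_left_cancel h4).symm
      exact smul_right_injective _ h0 h7
    rw [h3, hr0]
    have h4 := hSd ![0, 0, 1, 0]
    rw [hΘd] at h4
    simp at h4
    exact h4
  have hki : ∀ i, ContDiff ℝ (⊤ : ℕ∞) (fun q => k q i) := contDiff_pi.1 hk
  have hkpos : ∀ᶠ q in 𝓝 (0 : (ℝ × ℝ) × ℝ), 0 < k q 2 := by
    refine (hki 2).continuous.continuousAt.eventually (lt_mem_nhds ?_)
    simp [hk0]
  let a : (ℝ × ℝ) × ℝ → ℝ × ℝ := fun q => (q.1.1 + k q 0 * q.2 ^ 2, q.1.2 + k q 1 * q.2 ^ 2)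
  let y : (ℝ × ℝ) × ℝ → ℝ := fun q => √(k q 2) * q.2
  have ha : ContDiff ℝ (⊤ : ℕ∞) a := by
    have h1 : ContDiff ℝ (⊤ : ℕ∞) (fun q : (ℝ × ℝ) × ℝ => q.2 ^ 2) := by fun_prop
    have h2 : ContDiff ℝ (⊤ : ℕ∞) (fun q : (ℝ × ℝ) × ℝ => q.1.1) := by fun_prop
    have h3 : ContDiff ℝ (⊤ : ℕ∞) (fun q : (ℝ × ℝ) × ℝ => q.1.2) := by fun_prop
    exact (h2.add ((hki 0).mul h1)).prodMk (h3.add ((hki 1).mul h1))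
  have hys : ∀ᶠ q in 𝓝 (0 : (ℝ × ℝ) × ℝ), ContDiffAt ℝ (⊤ : ℕ∞) y q := by
    filter_upwards [hkpos] with q hq
    exact ((hki 2).contDiffAt.sqrt hq.ne').mul contDiffAt_snd
  have hχd : HasFDerivAt (fun q => (a q, y q)) (ContinuousLinearMap.id ℝ _) 0 := by
    have h1 : HasFDerivAt (fun q : (ℝ × ℝ) × ℝ => q.2) (ContinuousLinearMap.snd ℝ (ℝ × ℝ) ℝ) 0 := hasFDerivAt_snd
    have h2 : HasFDerivAt (fun q : (ℝ × ℝ) × ℝ => q.2 ^ 2) (0 : (ℝ × ℝ) × ℝ →L[ℝ] ℝ) 0 := by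
      have := h1.pow 2
      simpa using this
    have hf : HasFDerivAt (fun q : (ℝ × ℝ) × ℝ => q.1) (ContinuousLinearMap.fst ℝ (ℝ × ℝ) ℝ) 0 := hasFDerivAt_fst
    have h3 := fun i => hasFDerivAt_mul_vanish (hki i).continuous.continuousAt h2 (by simp)
    have h4 := hasFDerivAt_mul_vanish (κ := fun q => √(k q 2))
      (hki 2).continuous.continuousAt.sqrt h1 (by simp)
    have h5 := ((hf.fst.add (h3 0)).prodMk (hf.snd.add (h3 1))).prodMk h4
    refine h5.congr_fderiv ?_
    ext <;> simp [hk0]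
  have hχ0 : (a 0, y 0) = 0 := by simp [a, y]
  obtain ⟨R, hR0, hRs, hRL, hRR, hRd, hRb⟩ := local_inv (T := fun q => (a q, y q)) (p := (0 : (ℝ × ℝ) × ℝ)) (by
    filter_upwards [hys] with q hq
    exact ha.contDiffAt.prodMk hq) (by rw [hχd.fderiv]; exact Function.bijective_id)
  simp only [hχ0] at hR0 hRs hRR
  have hRt : Tendsto R (𝓝 0) (𝓝 0) := by
    have := hRs.self_of_nhds.continuousAt
    rwa [ContinuousAt, hR0] at this
  obtain ⟨e, he, hee⟩ := extend_germ (h := fun v => k (R v) 3 / k (R v) 2) (p := (0 : (ℝ × ℝ) × ℝ)) (by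
    filter_upwards [hRs, hRt.eventually hkpos] with v h1 h2
    exact ((hki 3).contDiffAt.comp v h1).div ((hki 2).contDiffAt.comp v h1) h2.ne')
  have hχt : Tendsto (fun q => (a q, y q)) (𝓝 0) (𝓝 0) := by
    have := hχd.continuousAt
    rwa [ContinuousAt, hχ0] at this
  refine ⟨S, a, y, e, hSs.self_of_nhds, hSb, hS0, ha.contDiffAt, hys.self_of_nhds,
    by simp [a], by simp [y], hχd, he, ?_⟩
  have hfst : Tendsto (fun q : (ℝ × ℝ) × ℝ => q.1) (𝓝 0) (𝓝 0) := by
    have : Continuous (fun q : (ℝ × ℝ) × ℝ => q.1) := continuous_fst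
    exact this.tendsto 0
  filter_upwards [hf2e, hχt.eventually hee, hRL, hkpos, hfst.eventually hk1, hfst.eventually hf20] with q h1 h2 h3 h4 h5 h6
  have h7 : f2 q = ![q.1.1, q.1.2, 0, 0] + q.2 ^ 2 • k q := by
    rw [← h6]; exact h5 q.2
  rw [h2, h3]
  have h8 : y q ^ 2 = q.2 ^ 2 * k q 2 := by
    simp only [y]; rw [mul_pow, Real.sq_sqrt h4.le, mul_comm]
  have h9 : S (F0 q.1 + q.2 ^ 2 • g q) = f2 q := h1.symm
  rw [h9, h8, h7]
  ext i
  fin_cases i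
  · simp [a, mul_comm]
  · simp [a, mul_comm]
  · simp
  · simp
    field_simp

lemma suff2 {e : (ℝ × ℝ) × ℝ → ℝ} (he : ContDiff ℝ (⊤ : ℕ∞) e)
    (h0 : fderiv ℝ e (0, 0) (0, 1) = 0)
    (h1 : fderiv ℝ (fun v : ℝ × ℝ => fderiv ℝ e (v, 0) (0, 1)) 0 ≠ 0) :
    ∃ (φ : (ℝ × ℝ) × ℝ → ℝ × ℝ × ℝ) (Φ : E4 → E4),
      ContDiffAt ℝ (⊤ : ℕ∞) φ 0 ∧ Function.Bijective (fderiv ℝ φ 0) ∧ φ 0 = 0 ∧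
      ContDiffAt ℝ (⊤ : ℕ∞) Φ 0 ∧ Function.Bijective (fderiv ℝ Φ 0) ∧ Φ 0 = 0 ∧
      ∀ q, Φ ![q.1.1, q.1.2, q.2 ^ 2, q.2 ^ 2 * e q] =
        ![(φ q).1, (φ q).2.1, (φ q).2.2 ^ 2, (φ q).2.1 * (φ q).2.2 ^ 3] := by
  obtain ⟨E1, E2, hE1, hE2, hE⟩ := whitney_split e he
  have hι : Tendsto (fun u : ℝ × ℝ => (u, (0:ℝ))) (𝓝 0) (𝓝 0) := by
    have : Continuous (fun u : ℝ × ℝ => (u, (0:ℝ))) := by fun_prop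
    exact this.tendsto 0
  have hdiff : ∀ {E : (ℝ × ℝ) × ℝ → ℝ}, ContDiffAt ℝ (⊤ : ℕ∞) E 0 →
      ∀ᶠ u in 𝓝 (0 : ℝ × ℝ), DifferentiableAt ℝ E (u, 0) := by
    intro E hE
    have := ((contDiffAt_infty.1 hE 1).eventually (by simp))
    filter_upwards [hι.eventually this] with u hu using hu.differentiableAt (by simp)
  have hev : ∀ᶠ v in 𝓝 (0 : ℝ × ℝ), fderiv ℝ e (v, 0) (0, 1) = E2 (v, 0) := by
    filter_upwards [hdiff hE1, hdiff hE2] with v k1 k2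
    have hl : HasDerivAt (fun x : ℝ => (v, x)) ((0 : ℝ × ℝ), (1:ℝ)) 0 :=
      (hasDerivAt_const (0:ℝ) v).prodMk (hasDerivAt_id (0:ℝ))
    have hl2 : HasDerivAt (fun x : ℝ => (v, x ^ 2)) ((0 : ℝ × ℝ), (0:ℝ)) 0 := by
      have := (hasDerivAt_const (0:ℝ) v).prodMk ((hasDerivAt_id (0:ℝ)).pow 2)
      simpa using this
    have d1 : HasDerivAt (fun x : ℝ => e (v, x)) (fderiv ℝ e (v, 0) (0, 1)) 0 :=
      HasFDerivAt.comp_hasDerivAt (0:ℝ) (he.differentiable (by simp) (v, 0)).hasFDerivAt hl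
    have k1' : HasFDerivAt E1 (fderiv ℝ E1 (v, 0)) (v, (0:ℝ) ^ 2) := by
      simpa using k1.hasFDerivAt
    have k2' : HasFDerivAt E2 (fderiv ℝ E2 (v, 0)) (v, (0:ℝ) ^ 2) := by
      simpa using k2.hasFDerivAt
    have d2 := HasFDerivAt.comp_hasDerivAt (f := fun x : ℝ => (v, x ^ 2)) (0:ℝ) k1' hl2
    have d3 := HasFDerivAt.comp_hasDerivAt (f := fun x : ℝ => (v, x ^ 2)) (0:ℝ) k2' hl2
    have d4 := d2.add ((hasDerivAt_id (0:ℝ)).mul d3)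
    have d5 := d1.unique (d4.congr_of_eventuallyEq (Eventually.of_forall fun x => hE v x))
    have hz : ((0 : ℝ × ℝ), (0:ℝ)) = 0 := rfl
    rw [hz, map_zero, map_zero] at d5
    simpa using d5
  have hE20 : E2 0 = 0 := by
    have := hev.self_of_nhds
    rw [← Prod.mk_zero_zero, ← this]; exact h0
  let D : ℝ × ℝ →L[ℝ] ℝ := (fderiv ℝ E2 0).comp (ContinuousLinearMap.inl ℝ (ℝ × ℝ) ℝ)
  have hD : fderiv ℝ (fun v : ℝ × ℝ => fderiv ℝ e (v, 0) (0, 1)) 0 = D := by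
    have d2 : HasFDerivAt (fun u : ℝ × ℝ => E2 (u, 0)) D 0 :=
      HasFDerivAt.comp 0 (hE2.differentiableAt (by simp)).hasFDerivAt (hasFDerivAt_prodMk_left 0 (0:ℝ))
    exact (d2.congr_of_eventuallyEq hev).fderiv
  rw [hD] at h1
  set α := D (1, 0) with hα
  set β := D (0, 1) with hβ
  have hDl : ∀ w : ℝ × ℝ, D w = α * w.1 + β * w.2 := by
    intro w
    have : w = w.1 • ((1:ℝ), (0:ℝ)) + w.2 • ((0:ℝ), (1:ℝ)) := by simp
    conv_lhs => rw [this, map_add, map_smul, map_smul]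
    simp [hα, hβ, mul_comm]
  have hαβ : α ^ 2 + β ^ 2 ≠ 0 := by
    intro h
    have ha : α = 0 := by nlinarith [sq_nonneg α, sq_nonneg β]
    have hb : β = 0 := by nlinarith [sq_nonneg α, sq_nonneg β]
    apply h1
    refine ContinuousLinearMap.ext fun w => ?_
    rw [hDl, ha, hb]; simp
  have hkey : ∀ w : ℝ × ℝ, -β * w.1 + α * w.2 = 0 → D w = 0 → w = 0 := by
    intro w k1 k2
    rw [hDl] at k2
    have e1 : (α ^ 2 + β ^ 2) * w.1 = 0 := by linear_combination α * k2 - β * k1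
    have e2 : (α ^ 2 + β ^ 2) * w.2 = 0 := by linear_combination β * k2 + α * k1
    exact Prod.ext ((mul_eq_zero.1 e1).resolve_left hαβ) ((mul_eq_zero.1 e2).resolve_left hαβ)
  let m : (ℝ × ℝ) × ℝ → (ℝ × ℝ) × ℝ := fun q => (q.1, q.2 ^ 2)
  have hm : ContDiff ℝ (⊤ : ℕ∞) m := by
    have : ContDiff ℝ (⊤ : ℕ∞) (fun q : (ℝ × ℝ) × ℝ => (q.1, q.2 ^ 2)) := by fun_prop
    exact this
  have hm0 : m 0 = 0 := by simp [m]
  have hmd : HasFDerivAt m ((ContinuousLinearMap.fst ℝ (ℝ × ℝ) ℝ).prod 0) 0 := by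
    have h1 : HasFDerivAt (fun q : (ℝ × ℝ) × ℝ => q.2) (ContinuousLinearMap.snd ℝ (ℝ × ℝ) ℝ) 0 := hasFDerivAt_snd
    have h2 : HasFDerivAt (fun q : (ℝ × ℝ) × ℝ => q.2 ^ 2) (0 : (ℝ × ℝ) × ℝ →L[ℝ] ℝ) 0 := by
      have := h1.pow 2
      simpa using this
    exact hasFDerivAt_fst.prodMk h2
  let n : E4 → (ℝ × ℝ) × ℝ := fun x => ((x 0, x 1), x 2)
  let pr : Fin 4 → (E4 →L[ℝ] ℝ) := fun i => ContinuousLinearMap.proj i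
  have hp : ∀ i, HasFDerivAt (fun v : E4 => v i) (pr i) 0 := fun i => (pr i).hasFDerivAt
  have hpc : ∀ i : Fin 4, ContDiff ℝ (⊤ : ℕ∞) (fun v : E4 => v i) := fun i => contDiff_apply ℝ ℝ i
  have hn : ContDiff ℝ (⊤ : ℕ∞) n := ((hpc 0).prodMk (hpc 1)).prodMk (hpc 2)
  have hn0 : n 0 = 0 := rfl
  have hnd : HasFDerivAt n (((pr 0).prod (pr 1)).prod (pr 2)) 0 := ((hp 0).prodMk (hp 1)).prodMk (hp 2)
  have hE2m : ContDiffAt ℝ (⊤ : ℕ∞) (fun q => E2 (m q)) 0 :=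
    ContDiffAt.comp (g := E2) (f := m) 0 (by rw [hm0]; exact hE2) hm.contDiffAt
  have hEn : ∀ {E : (ℝ × ℝ) × ℝ → ℝ}, ContDiffAt ℝ (⊤ : ℕ∞) E 0 →
      ContDiffAt ℝ (⊤ : ℕ∞) (fun q => E (n q)) 0 := fun {E} hE =>
    ContDiffAt.comp (g := E) (f := n) 0 (by rw [hn0]; exact hE) hn.contDiffAt
  have hE2d : HasFDerivAt E2 (fderiv ℝ E2 0) 0 := (hE2.differentiableAt (by simp)).hasFDerivAt
  have hE1d : HasFDerivAt E1 (fderiv ℝ E1 0) 0 := (hE1.differentiableAt (by simp)).hasFDerivAt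
  have dE2m : HasFDerivAt (fun q => E2 (m q)) ((fderiv ℝ E2 0).comp ((ContinuousLinearMap.fst ℝ (ℝ × ℝ) ℝ).prod 0)) 0 :=
    HasFDerivAt.comp (g := E2) (f := m) 0 (by rw [hm0]; exact hE2d) hmd
  have dE2n : HasFDerivAt (fun q => E2 (n q)) ((fderiv ℝ E2 0).comp (((pr 0).prod (pr 1)).prod (pr 2))) 0 :=
    HasFDerivAt.comp (g := E2) (f := n) 0 (by rw [hn0]; exact hE2d) hnd
  have cE1n : ContinuousAt (fun q => E1 (n q)) 0 := (hEn hE1).continuousAt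
  let φ : (ℝ × ℝ) × ℝ → ℝ × ℝ × ℝ := fun q => (-β * q.1.1 + α * q.1.2, E2 (m q), q.2)
  let Φ : E4 → E4 := fun x => ![-β * x 0 + α * x 1, E2 (n x), x 2, x 3 - E1 (n x) * x 2]
  have hφ : ContDiffAt ℝ (⊤ : ℕ∞) φ 0 := by
    have h1 : ContDiff ℝ (⊤ : ℕ∞) (fun q : (ℝ × ℝ) × ℝ => -β * q.1.1 + α * q.1.2) := by fun_prop
    exact h1.contDiffAt.prodMk (hE2m.prodMk contDiffAt_snd)
  have hΦ : ContDiffAt ℝ (⊤ : ℕ∞) Φ 0 := by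
    refine contDiffAt_pi.2 fun i => ?_
    fin_cases i
    · exact ((contDiff_const.mul (hpc 0)).add (contDiff_const.mul (hpc 1))).contDiffAt
    · exact hEn hE2
    · exact (hpc 2).contDiffAt
    · exact (hpc 3).contDiffAt.sub ((hEn hE1).mul (hpc 2).contDiffAt)
  have dφ : ∀ w, fderiv ℝ φ 0 w = (-β * w.1.1 + α * w.1.2, D w.1, w.2) := by
    intro w
    have hf : HasFDerivAt (fun q : (ℝ × ℝ) × ℝ => q.1) (ContinuousLinearMap.fst ℝ (ℝ × ℝ) ℝ) 0 := hasFDerivAt_fst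
    have h1 : HasFDerivAt φ _ 0 := ((hf.fst.const_mul (-β)).add (hf.snd.const_mul α)).prodMk
      (dE2m.prodMk hasFDerivAt_snd)
    rw [h1.fderiv]
    simp [D]
  have dΦ : ∀ w, fderiv ℝ Φ 0 w = ![-β * w 0 + α * w 1, fderiv ℝ E2 0 ((w 0, w 1), w 2), w 2,
      w 3 - E1 0 * w 2] := by
    intro w
    have hΦd := hasFDerivAt_pi'.1 (hΦ.differentiableAt (by simp)).hasFDerivAt
    ext i
    fin_cases i
    · have h1 := (hΦd 0).unique (((hp 0).const_mul (-β)).add ((hp 1).const_mul α))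
      simpa [pr] using DFunLike.congr_fun h1 w
    · have h1 := (hΦd 1).unique dE2n
      simpa [pr] using DFunLike.congr_fun h1 w
    · have h1 := (hΦd 2).unique (hp 2)
      simpa [pr] using DFunLike.congr_fun h1 w
    · have h1 := (hΦd 3).unique ((hp 3).sub (hasFDerivAt_mul_vanish cE1n (hp 2) rfl))
      simpa [pr, hn0] using DFunLike.congr_fun h1 w
  refine ⟨φ, Φ, hφ, ?_, ?_, hΦ, ?_, ?_, ?_⟩
  · have hi : ∀ w, fderiv ℝ φ 0 w = 0 → w = 0 := by
      intro w hw
      rw [dφ, Prod.mk_eq_zero, Prod.mk_eq_zero] at hw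
      exact Prod.ext (hkey _ hw.1 hw.2.1) hw.2.2
    have hi' : Function.Injective (fderiv ℝ φ 0 : ((ℝ × ℝ) × ℝ) →ₗ[ℝ] (ℝ × ℝ × ℝ)) := (injective_iff_map_eq_zero _).2 hi
    refine ⟨hi', ?_⟩
    exact (LinearMap.injective_iff_surjective_of_finrank_eq_finrank (by simp)).1 hi'
  · simp [φ, hm0, hE20]
  · refine bij_of_inj _ fun w hw => ?_
    rw [dΦ] at hw
    have k0 := congrFun hw 0
    have k1 := congrFun hw 1
    have k2 := congrFun hw 2
    have k3 := congrFun hw 3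
    simp at k0 k1 k2 k3
    rw [k2] at k1 k3
    have := hkey (w 0, w 1) (by simpa using k0) (by simpa [D] using k1)
    simp at this k3
    ext i
    fin_cases i
    · exact this.1
    · exact this.2
    · exact k2
    · exact k3
  · ext i
    fin_cases i <;> simp [Φ, hn0, hE20]
  · intro q
    have h1 : n ![q.1.1, q.1.2, q.2 ^ 2, q.2 ^ 2 * e q] = m q := rfl
    have h2 : e q = E1 (m q) + q.2 * E2 (m q) := hE q.1 q.2
    simp only [Φ, h1, φ]
    ext i
    fin_cases i
    · simp
    · simp
    · simp
    · simp [h2]; ring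

lemma suff {F0 : ℝ × ℝ → E4} (hF0 : ContDiff ℝ (⊤ : ℕ∞) F0)
    {g : (ℝ × ℝ) × ℝ → E4} (hg : ContDiff ℝ (⊤ : ℕ∞) g) {ν0 : E4}
    (hd : det4 (fderiv ℝ F0 0 (1, 0)) (fderiv ℝ F0 0 (0, 1)) (g 0) ν0 ≠ 0)
    (hD : Delta F0 g 0 = 0 ∧ fderiv ℝ (Delta F0 g) 0 ≠ 0) :
    ∃ (φ : (ℝ × ℝ) × ℝ → ℝ × ℝ × ℝ) (Φ : E4 → E4),
      ContDiffAt ℝ (⊤ : ℕ∞) φ 0 ∧ Function.Bijective (fderiv ℝ φ 0) ∧ φ 0 = 0 ∧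
      IsDiffeoGermAt Φ (F0 0) ∧ Φ (F0 0) = 0 ∧
      ∀ᶠ q in 𝓝 (0 : (ℝ × ℝ) × ℝ), Φ (F0 q.1 + q.2 ^ 2 • g q) =
        ![(φ q).1, (φ q).2.1, (φ q).2.2 ^ 2, (φ q).2.1 * (φ q).2.2 ^ 3] := by
  obtain ⟨S, a, y, e, hS, hSb, hS0, ha, hy, ha0, hy0, hχ, he, heq⟩ := suff1 hF0 hg hd
  have hc := (key_inv hF0 hg hS hSb ha hy ha0
    (by rw [hχ.fderiv]; exact Function.injective_id) he heq (Eventually.of_forall hy0)).1 hD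
  obtain ⟨φ, Φ, hφ, hφb, hφ0, hΦ, hΦb, hΦ0, h⟩ := suff2 he hc.1 hc.2
  have hχ0 : (a 0, y 0) = 0 := by
    have : y 0 = 0 := hy0 0
    rw [ha0, this]; rfl
  refine ⟨fun q => φ (a q, y q), fun x => Φ (S x), ?_, ?_, ?_, ⟨?_, ?_⟩, ?_, ?_⟩
  · exact ContDiffAt.comp (g := φ) (f := fun q => (a q, y q)) 0 (by rw [hχ0]; exact hφ) (ha.prodMk hy)
  · have h1 : HasFDerivAt φ (fderiv ℝ φ 0) (a 0, y 0) := by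
      rw [hχ0]; exact (hφ.differentiableAt (by simp)).hasFDerivAt
    have h2 := HasFDerivAt.comp (g := φ) (f := fun q => (a q, y q)) 0 h1 hχ
    rw [ContinuousLinearMap.comp_id] at h2
    have h3 : fderiv ℝ (fun q => φ (a q, y q)) 0 = _ := h2.fderiv
    rw [h3]; exact hφb
  · simp only [hχ0, hφ0]
  · exact ContDiffAt.comp (g := Φ) (f := S) (F0 0) (by rw [hS0]; exact hΦ) hS
  · have h1 : HasFDerivAt Φ (fderiv ℝ Φ 0) (S (F0 0)) := by
      rw [hS0]; exact (hΦ.differentiableAt (by simp)).hasFDerivAt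
    have h2 := HasFDerivAt.comp (g := Φ) (f := S) (F0 0) h1 (hS.differentiableAt (by simp)).hasFDerivAt
    have h3 : fderiv ℝ (fun q => Φ (S q)) (F0 0) = _ := h2.fderiv
    rw [h3]; exact hΦb.comp hSb
  · simp only [hS0, hΦ0]
  · filter_upwards [heq] with q hq
    rw [hq]
    exact h (a q, y q)

lemma nec {F0 : ℝ × ℝ → E4} (hF0 : ContDiff ℝ (⊤ : ℕ∞) F0)
    {g : (ℝ × ℝ) × ℝ → E4} (hg : ContDiff ℝ (⊤ : ℕ∞) g)
    {φ : (ℝ × ℝ) × ℝ → ℝ × ℝ × ℝ} {Φ : E4 → E4}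
    (hφ : ContDiffAt ℝ (⊤ : ℕ∞) φ 0) (hφb : Function.Injective (fderiv ℝ φ 0)) (hφ0 : φ 0 = 0)
    (hΦ : IsDiffeoGermAt Φ (F0 0))
    (heq : ∀ᶠ q in 𝓝 (0 : (ℝ × ℝ) × ℝ), Φ (F0 q.1 + q.2 ^ 2 • g q) =
        ![(φ q).1, (φ q).2.1, (φ q).2.2 ^ 2, (φ q).2.1 * (φ q).2.2 ^ 3]) :
    Delta F0 g 0 = 0 ∧ fderiv ℝ (Delta F0 g) 0 ≠ 0 := by
  let a : (ℝ × ℝ) × ℝ → ℝ × ℝ := fun q => ((φ q).1, (φ q).2.1)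
  let y : (ℝ × ℝ) × ℝ → ℝ := fun q => (φ q).2.2
  have ha : ContDiffAt ℝ (⊤ : ℕ∞) a 0 := hφ.fst.prodMk hφ.snd.fst
  have hy : ContDiffAt ℝ (⊤ : ℕ∞) y 0 := hφ.snd.snd
  have ha0 : a 0 = 0 := by simp [a, hφ0]
  have hay : ∀ w, fderiv ℝ (fun q => (a q, y q)) 0 w =
      (((fderiv ℝ φ 0 w).1, (fderiv ℝ φ 0 w).2.1), (fderiv ℝ φ 0 w).2.2) := by
    intro w
    have h := (hφ.differentiableAt (by simp)).hasFDerivAt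
    have h1 : HasFDerivAt (fun q => (a q, y q)) _ 0 := (h.fst.prodMk h.snd.fst).prodMk h.snd.snd
    rw [h1.fderiv]; rfl
  have hinj : Function.Injective (fderiv ℝ (fun q => (a q, y q)) 0) := by
    intro v w hvw
    apply hφb
    rw [hay, hay] at hvw
    simp only [Prod.mk.injEq] at hvw
    exact Prod.ext hvw.1.1 (Prod.ext hvw.1.2 hvw.2)
  have hι : Tendsto (fun u : ℝ × ℝ => (u, (0:ℝ))) (𝓝 0) (𝓝 0) := by
    have : Continuous (fun u : ℝ × ℝ => (u, (0:ℝ))) := by fun_prop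
    exact this.tendsto 0
  have hdφ : ∀ᶠ u in 𝓝 (0 : ℝ × ℝ), DifferentiableAt ℝ φ (u, 0) := by
    have := ((contDiffAt_infty.1 hφ 1).eventually (by simp))
    filter_upwards [hι.eventually this] with u hu using hu.differentiableAt (by simp)
  have hΦ2 : ∀ᶠ u in 𝓝 (0 : ℝ × ℝ), ContDiffAt ℝ 2 Φ (F0 u) :=
    (hF0.continuous.tendsto 0).eventually ((contDiffAt_infty.1 hΦ.1 2).eventually (by simp))
  have heq2 : ∀ᶠ u in 𝓝 (0 : ℝ × ℝ), ∀ᶠ x in 𝓝 (0 : ℝ), Φ (F0 u + x ^ 2 • g (u, x)) =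
      ![(φ (u, x)).1, (φ (u, x)).2.1, (φ (u, x)).2.2 ^ 2, (φ (u, x)).2.1 * (φ (u, x)).2.2 ^ 3] :=
    Eventually.curry_nhds (x := (0 : ℝ × ℝ)) (y := (0 : ℝ)) heq
  have hder : ∀ᶠ u in 𝓝 (0 : ℝ × ℝ), (fderiv ℝ φ (u, 0) (0, 1)).1 = 0 ∧
      (fderiv ℝ φ (u, 0) (0, 1)).2.1 = 0 ∧
      y (u, 0) * (fderiv ℝ φ (u, 0) (0, 1)).2.2 = 0 := by
    filter_upwards [hdφ, hΦ2, heq2] with u h1 h2 h3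
    have hl : HasDerivAt (fun x : ℝ => (u, x)) ((0 : ℝ × ℝ), (1:ℝ)) 0 :=
      (hasDerivAt_const (0:ℝ) u).prodMk (hasDerivAt_id (0:ℝ))
    have hv : HasDerivAt (fun x : ℝ => g (u, x)) (fderiv ℝ g (u, 0) (0, 1)) 0 :=
      HasFDerivAt.comp_hasDerivAt (0:ℝ) (hg.differentiable (by simp) (u, 0)).hasFDerivAt hl
    have hp : HasDerivAt (fun x : ℝ => φ (u, x)) (fderiv ℝ φ (u, 0) (0, 1)) 0 :=
      HasFDerivAt.comp_hasDerivAt (0:ℝ) h1.hasFDerivAt hl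
    obtain ⟨r, hr0, hr1, hr2⟩ := curve_expand h2 hv
    have d2 : HasDerivAt (fun x : ℝ => Φ (F0 u + x ^ 2 • g (u, x))) 0 0 := by
      have := (((hasDerivAt_id (0:ℝ)).pow 2).smul hr1).const_add (Φ (F0 u))
      simp only [hr2]
      simpa using this
    have d3 := hasDerivAt_pi.1 (d2.congr_of_eventuallyEq (h3.mono fun _ h => h.symm))
    have hpf := hp.hasFDerivAt
    have p1 : HasDerivAt (fun x : ℝ => (φ (u, x)).1) (fderiv ℝ φ (u, 0) (0, 1)).1 0 := by
      simpa using hpf.fst.hasDerivAt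
    have p2 : HasDerivAt (fun x : ℝ => (φ (u, x)).2.1) (fderiv ℝ φ (u, 0) (0, 1)).2.1 0 := by
      simpa using hpf.snd.fst.hasDerivAt
    have p3' : HasDerivAt (fun x : ℝ => (φ (u, x)).2.2) (fderiv ℝ φ (u, 0) (0, 1)).2.2 0 := by
      simpa using hpf.snd.snd.hasDerivAt
    have p3 := p3'.pow 2
    have q1 := p1.unique (d3 0)
    have q2 := p2.unique (d3 1)
    have q3 := p3.unique (d3 2)
    refine ⟨q1, q2, ?_⟩
    simp at q3
    simpa [y] using q3
  have hb0 : (fderiv ℝ φ 0 (0, 1)).2.2 ≠ 0 := by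
    intro h
    have h1 := hder.self_of_nhds
    have h2 : fderiv ℝ φ 0 (0, 1) = 0 := Prod.ext h1.1 (Prod.ext h1.2.1 h)
    have := hφb (h2.trans (map_zero _).symm)
    simp at this
  have hbc : ContinuousAt (fun u : ℝ × ℝ => (fderiv ℝ φ (u, 0) (0, 1)).2.2) 0 := by
    have h1 : ContinuousAt (fderiv ℝ φ) ((0 : ℝ × ℝ), (0:ℝ)) :=
      (hφ.fderiv_right (m := 0) (by simp)).continuousAt
    have h2 : ContinuousAt (fun u : ℝ × ℝ => fderiv ℝ φ (u, 0)) 0 :=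
      ContinuousAt.comp (f := fun u : ℝ × ℝ => (u, (0:ℝ))) h1 (by fun_prop)
    exact (h2.clm_apply continuousAt_const).snd.snd
  have hy0 : ∀ᶠ u in 𝓝 (0 : ℝ × ℝ), y (u, 0) = 0 := by
    filter_upwards [hder, hbc.eventually_ne hb0] with u h1 h2
    exact (mul_eq_zero.1 h1.2.2).resolve_right h2
  let e : (ℝ × ℝ) × ℝ → ℝ := fun v => v.1.2 * v.2
  have he : ContDiff ℝ (⊤ : ℕ∞) e := by
    have : ContDiff ℝ (⊤ : ℕ∞) (fun v : (ℝ × ℝ) × ℝ => v.1.2 * v.2) := by fun_prop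
    exact this
  have hed : ∀ v : ℝ × ℝ, fderiv ℝ e (v, 0) (0, 1) = v.2 := by
    intro v
    have k1 : HasFDerivAt (fun q : (ℝ × ℝ) × ℝ => q.1) (ContinuousLinearMap.fst ℝ (ℝ × ℝ) ℝ) (v, 0) := hasFDerivAt_fst
    have k2 : HasFDerivAt (fun q : (ℝ × ℝ) × ℝ => q.2) (ContinuousLinearMap.snd ℝ (ℝ × ℝ) ℝ) (v, 0) := hasFDerivAt_snd
    have h1 : HasFDerivAt e _ (v, 0) := k1.snd.mul k2
    rw [h1.fderiv]; simp
  refine (key_inv hF0 hg hΦ.1 hΦ.2 ha hy ha0 hinj he ?_ hy0).2 ⟨?_, ?_⟩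
  · filter_upwards [heq] with q hq
    rw [hq]
    ext i
    fin_cases i <;> simp [a, y, e]
    ring
  · exact hed 0
  · simp only [hed]
    intro h
    have h1 : fderiv ℝ (fun v : ℝ × ℝ => v.2) 0 = ContinuousLinearMap.snd ℝ ℝ ℝ := fderiv_snd
    rw [h1] at h
    have := DFunLike.congr_fun h (0, 1)
    simp at this

lemma dot4_expand (a b : E4) : dot4 a b = a 0 * b 0 + a 1 * b 1 + a 2 * b 2 + a 3 * b 3 := by
  simp [dot4, Fin.sum_univ_four]

lemma hasDerivAt_dot4 {a b : ℝ → E4} {a' b' : E4} {x : ℝ} (ha : HasDerivAt a a' x)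
    (hb : HasDerivAt b b' x) :
    HasDerivAt (fun t => dot4 (a t) (b t)) (dot4 a' (b x) + dot4 (a x) b') x := by
  have ha := hasDerivAt_pi.1 ha
  have hb := hasDerivAt_pi.1 hb
  simp only [dot4_expand]
  have := ((((ha 0).mul (hb 0)).add ((ha 1).mul (hb 1))).add ((ha 2).mul (hb 2))).add ((ha 3).mul (hb 3))
  refine this.congr_deriv ?_
  ring

lemma gram4 (a b c d a' b' c' d' : E4) : det4 a b c d * det4 a' b' c' d' =
    det4 ![dot4 a a', dot4 a b', dot4 a c', dot4 a d'] ![dot4 b a', dot4 b b', dot4 b c', dot4 b d']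
      ![dot4 c a', dot4 c b', dot4 c c', dot4 c d'] ![dot4 d a', dot4 d b', dot4 d c', dot4 d d'] := by
  have h : Matrix.det (Matrix.of ![a', b', c', d']) =
      Matrix.det (Matrix.of ![a', b', c', d']).transpose := (Matrix.det_transpose _).symm
  rw [det4, det4, h, ← Matrix.det_mul, det4]
  congr 1
  ext i j
  rw [Matrix.mul_apply]
  fin_cases i <;> fin_cases j <;> rfl

lemma cramer4 (A B C D w n : E4) (hA : dot4 A n = 0) (hB : dot4 B n = 0) (hC : dot4 C n = 0) :
    det4 A B C D * dot4 w n = det4 A B C w * dot4 D n := by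
  have key : ∀ i, det4 A B C D * w i = det4 w B C D * A i + det4 A w C D * B i
      + det4 A B w D * C i + det4 A B C w * D i := by
    intro i
    simp only [det4_expand]
    fin_cases i <;> simp <;> ring
  rw [dot4_expand] at *
  rw [dot4_expand]
  linear_combination n 0 * key 0 + n 1 * key 1 + n 2 * key 2 + n 3 * key 3
    + det4 w B C D * hA + det4 A w C D * hB + det4 A B w D * hC

lemma psi_alg {A B g0 g1 n N : E4} (hA : dot4 A n = 0) (hB : dot4 B n = 0) (hg : dot4 g0 n = 0)
    (hAN : dot4 A N = 0) (hBN : dot4 B N = 0) (h3 : 3 * dot4 g1 n + 2 * dot4 g0 N = 0) :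
    det4 A B g0 n ^ 2 * det4 A B n N =
      (3 / 2 * (dot4 A A * dot4 B B - dot4 A B ^ 2) * dot4 n n ^ 2) * det4 A B g0 g1 := by
  have comm : ∀ a b, dot4 a b = dot4 b a := by
    intro a b; simp only [dot4_expand]; ring
  have c1 := cramer4 A B g0 n g1 n hA hB hg
  have c2 := gram4 A B n N A B g0 n
  rw [det4_expand ![_, _, _, _]] at c2
  simp only [comm n A, comm n B, comm N A, comm N B, comm B A, comm n g0, comm N g0, hA, hB, hg, hAN, hBN] at c2
  simp at c2
  have c3 : det4 A B n N * det4 A B g0 n = - (dot4 A A * dot4 B B - dot4 A B ^ 2) * dot4 n n * dot4 g0 N := by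
    rw [c2]; ring
  linear_combination det4 A B g0 n * c3 - 1 / 2 * det4 A B g0 n * (dot4 A A * dot4 B B - dot4 A B ^ 2) * dot4 n n * h3 + 3 / 2 * (dot4 A A * dot4 B B - dot4 A B ^ 2) * dot4 n n * c1

lemma gram2_ne {A B C D : E4} (h : det4 A B C D ≠ 0) : dot4 A A * dot4 B B - dot4 A B ^ 2 ≠ 0 := by
  intro h0
  have hl : (A 0 * B 1 - A 1 * B 0) ^ 2 + (A 0 * B 2 - A 2 * B 0) ^ 2 + (A 0 * B 3 - A 3 * B 0) ^ 2
      + (A 1 * B 2 - A 2 * B 1) ^ 2 + (A 1 * B 3 - A 3 * B 1) ^ 2 + (A 2 * B 3 - A 3 * B 2) ^ 2 = 0 := by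
    rw [← h0]; simp only [dot4_expand]; ring
  apply h
  rw [det4_expand]
  generalize A 0 * B 1 - A 1 * B 0 = p1 at *
  generalize A 0 * B 2 - A 2 * B 0 = p2 at *
  generalize A 0 * B 3 - A 3 * B 0 = p3 at *
  generalize A 1 * B 2 - A 2 * B 1 = p4 at *
  generalize A 1 * B 3 - A 3 * B 1 = p5 at *
  generalize A 2 * B 3 - A 3 * B 2 = p6 at *
  have e1 : p1 = 0 := by nlinarith [sq_nonneg p1, sq_nonneg p2, sq_nonneg p3, sq_nonneg p4, sq_nonneg p5, sq_nonneg p6]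
  have e2 : p2 = 0 := by nlinarith [sq_nonneg p1, sq_nonneg p2, sq_nonneg p3, sq_nonneg p4, sq_nonneg p5, sq_nonneg p6]
  have e3 : p3 = 0 := by nlinarith [sq_nonneg p1, sq_nonneg p2, sq_nonneg p3, sq_nonneg p4, sq_nonneg p5, sq_nonneg p6]
  have e4 : p4 = 0 := by nlinarith [sq_nonneg p1, sq_nonneg p2, sq_nonneg p3, sq_nonneg p4, sq_nonneg p5, sq_nonneg p6]
  have e5 : p5 = 0 := by nlinarith [sq_nonneg p1, sq_nonneg p2, sq_nonneg p3, sq_nonneg p4, sq_nonneg p5, sq_nonneg p6]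
  have e6 : p6 = 0 := by nlinarith [sq_nonneg p1, sq_nonneg p2, sq_nonneg p3, sq_nonneg p4, sq_nonneg p5, sq_nonneg p6]
  simp [e1, e2, e3, e4, e5, e6]

lemma ortho {F0 : ℝ × ℝ → E4} (hF0 : ContDiff ℝ (⊤ : ℕ∞) F0)
    {g : (ℝ × ℝ) × ℝ → E4} (hg : ContDiff ℝ (⊤ : ℕ∞) g)
    {n : (ℝ × ℝ) × ℝ → E4} (hn : ContDiff ℝ (⊤ : ℕ∞) n)
    (h : ∀ᶠ q in 𝓝 (0 : (ℝ × ℝ) × ℝ), ∀ w,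
      dot4 (fderiv ℝ (fun q : (ℝ × ℝ) × ℝ => F0 q.1 + q.2 ^ 2 • g q) q w) (n q) = 0) :
    ∀ᶠ u in 𝓝 (0 : ℝ × ℝ),
      (∀ w, dot4 (fderiv ℝ F0 u w) (n (u, 0)) = 0 ∧
        dot4 (fderiv ℝ F0 u w) (fderiv ℝ n (u, 0) (0, 1)) = 0) ∧
      dot4 (g (u, 0)) (n (u, 0)) = 0 ∧
      3 * dot4 (fderiv ℝ g (u, 0) (0, 1)) (n (u, 0))
        + 2 * dot4 (g (u, 0)) (fderiv ℝ n (u, 0) (0, 1)) = 0 := by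
  have hd : ∀ q w, fderiv ℝ (fun q : (ℝ × ℝ) × ℝ => F0 q.1 + q.2 ^ 2 • g q) q w =
      fderiv ℝ F0 q.1 w.1 + (q.2 ^ 2 • fderiv ℝ g q w + (2 * q.2 * w.2) • g q) := by
    intro q w
    have h1 : HasFDerivAt (fun q : (ℝ × ℝ) × ℝ => F0 q.1) _ q :=
      (hF0.differentiable (by simp) q.1).hasFDerivAt.comp q hasFDerivAt_fst
    have k2 : HasFDerivAt (fun q : (ℝ × ℝ) × ℝ => q.2) (ContinuousLinearMap.snd ℝ (ℝ × ℝ) ℝ) q := hasFDerivAt_snd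
    have h2 : HasFDerivAt (fun q : (ℝ × ℝ) × ℝ => q.2 ^ 2) _ q := k2.pow 2
    have h3 : HasFDerivAt (fun q : (ℝ × ℝ) × ℝ => F0 q.1 + q.2 ^ 2 • g q) _ q :=
      h1.add (h2.smul (hg.differentiable (by simp) q).hasFDerivAt)
    rw [HasFDerivAt.fderiv h3]
    simp
  have h2 : ∀ᶠ u in 𝓝 (0 : ℝ × ℝ), ∀ᶠ x in 𝓝 (0 : ℝ), ∀ w,
      dot4 (fderiv ℝ (fun q : (ℝ × ℝ) × ℝ => F0 q.1 + q.2 ^ 2 • g q) (u, x) w) (n (u, x)) = 0 :=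
    Eventually.curry_nhds (x := (0 : ℝ × ℝ)) (y := (0 : ℝ)) h
  filter_upwards [h2] with u hu
  have hl : HasDerivAt (fun x : ℝ => (u, x)) ((0 : ℝ × ℝ), (1:ℝ)) 0 :=
    (hasDerivAt_const (0:ℝ) u).prodMk (hasDerivAt_id (0:ℝ))
  have hgv : HasDerivAt (fun x : ℝ => g (u, x)) (fderiv ℝ g (u, 0) (0, 1)) 0 :=
    HasFDerivAt.comp_hasDerivAt (0:ℝ) (hg.differentiable (by simp) (u, 0)).hasFDerivAt hl
  have hnv : HasDerivAt (fun x : ℝ => n (u, x)) (fderiv ℝ n (u, 0) (0, 1)) 0 :=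
    HasFDerivAt.comp_hasDerivAt (0:ℝ) (hn.differentiable (by simp) (u, 0)).hasFDerivAt hl
  have hdg : ∀ w, ∃ z, HasDerivAt (fun x : ℝ => fderiv ℝ g (u, x) w) z 0 := by
    intro w
    have h1 : ContDiff ℝ (⊤ : ℕ∞) (fun x : ℝ => fderiv ℝ g (u, x) w) := by
      have := (hg.fderiv_right (m := (⊤ : ℕ∞)) (by simp))
      exact ContDiff.clm_apply (this.comp (contDiff_const.prodMk contDiff_id)) contDiff_const
    exact ⟨_, (h1.differentiable (by simp) 0).hasDerivAt⟩
  refine ⟨fun w => ?_, ?_⟩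
  · obtain ⟨z, hz⟩ := hdg (w, 0)
    have h1 : ∀ᶠ x in 𝓝 (0:ℝ), dot4 (fderiv ℝ F0 u w + x ^ 2 • fderiv ℝ g (u, x) (w, 0)) (n (u, x)) = 0 := by
      filter_upwards [hu] with x hx
      have := hx (w, 0)
      rw [hd] at this
      simpa using this
    have h3 : HasDerivAt (fun x : ℝ => fderiv ℝ F0 u w + x ^ 2 • fderiv ℝ g (u, x) (w, 0)) 0 0 := by
      have := (((hasDerivAt_id (0:ℝ)).pow 2).smul hz).const_add (fderiv ℝ F0 u w)
      simpa using this
    have h4 := (hasDerivAt_dot4 h3 hnv).unique ((hasDerivAt_const (0:ℝ) (0:ℝ)).congr_of_eventuallyEq h1)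
    have h5 := h1.self_of_nhds
    simp at h5
    refine ⟨h5, ?_⟩
    simpa [dot4] using h4
  · obtain ⟨z, hz⟩ := hdg (0, 1)
    have h3 : HasDerivAt (fun x : ℝ => (2:ℝ) • g (u, x) + x • fderiv ℝ g (u, x) (0, 1))
        ((2:ℝ) • fderiv ℝ g (u, 0) (0, 1) + fderiv ℝ g (u, 0) (0, 1)) 0 := by
      have := (hgv.const_smul (2:ℝ)).add ((hasDerivAt_id (0:ℝ)).smul hz)
      refine this.congr_deriv ?_
      simp
    have h4 := hasDerivAt_dot4 h3 hnv
    have h1 : ∀ᶠ x in 𝓝[≠] (0:ℝ), dot4 ((2:ℝ) • g (u, x) + x • fderiv ℝ g (u, x) (0, 1)) (n (u, x)) = 0 := by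
      filter_upwards [self_mem_nhdsWithin, hu.filter_mono nhdsWithin_le_nhds] with x h0 hx
      have h0 : x ≠ 0 := h0
      have := hx (0, 1)
      rw [hd] at this
      simp only [map_zero, zero_add, mul_one] at this
      apply mul_left_cancel₀ h0
      rw [mul_zero, ← this]
      simp only [dot4_expand]
      simp
      ring
    have h5 : dot4 ((2:ℝ) • g (u, 0) + (0:ℝ) • fderiv ℝ g (u, 0) (0, 1)) (n (u, 0)) = 0 := by
      refine tendsto_nhds_unique (h4.continuousAt.tendsto.mono_left nhdsWithin_le_nhds) (tendsto_const_nhds.congr' (h1.mono fun x hx => ?_))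
      exact hx.symm
    have h6 : ∀ᶠ x in 𝓝 (0:ℝ), dot4 ((2:ℝ) • g (u, x) + x • fderiv ℝ g (u, x) (0, 1)) (n (u, x)) = 0 := by
      rw [eventually_nhdsWithin_iff] at h1
      filter_upwards [h1] with x hx
      rcases eq_or_ne x 0 with rfl | h0
      · exact h5
      · exact hx h0
    have h7 := h4.unique ((hasDerivAt_const (0:ℝ) (0:ℝ)).congr_of_eventuallyEq h6)
    simp only [dot4_expand] at h5 h7 ⊢
    simp at h5 h7
    constructor
    · linarith
    · linarith

lemma det4_lin3 (D1 D2 D3 n : E4) (a b c : ℝ × ℝ × ℝ) :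
    det4 (a.1 • D1 + a.2.1 • D2 + a.2.2 • D3) (b.1 • D1 + b.2.1 • D2 + b.2.2 • D3)
      (c.1 • D1 + c.2.1 • D2 + c.2.2 • D3) n =
    (a.1 * (b.2.1 * c.2.2 - b.2.2 * c.2.1) - a.2.1 * (b.1 * c.2.2 - b.2.2 * c.1)
      + a.2.2 * (b.1 * c.2.1 - b.2.1 * c.1)) * det4 D1 D2 D3 n := by
  simp only [det4_expand]
  simp
  ring

/-- Comparison of `ψ` with the reduced invariant. -/
lemma psi_delta {F0 : ℝ × ℝ → E4} (hF0 : ContDiff ℝ (⊤ : ℕ∞) F0)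
    {g : (ℝ × ℝ) × ℝ → E4} (hg : ContDiff ℝ (⊤ : ℕ∞) g)
    {n : (ℝ × ℝ) × ℝ → E4} (hn : ContDiff ℝ (⊤ : ℕ∞) n)
    (h : ∀ᶠ q in 𝓝 (0 : (ℝ × ℝ) × ℝ), ∀ w,
      dot4 (fderiv ℝ (fun q : (ℝ × ℝ) × ℝ => F0 q.1 + q.2 ^ 2 • g q) q w) (n q) = 0)
    (hd : det4 (fderiv ℝ F0 0 (1, 0)) (fderiv ℝ F0 0 (0, 1)) (g 0) (n 0) ≠ 0) :
    ((det4 (fderiv ℝ F0 0 (1, 0)) (fderiv ℝ F0 0 (0, 1)) (n (0, 0)) (fderiv ℝ n (0, 0) (0, 1)) = 0) ∧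
      fderiv ℝ (fun u => det4 (fderiv ℝ F0 u (1, 0)) (fderiv ℝ F0 u (0, 1)) (n (u, 0))
        (fderiv ℝ n (u, 0) (0, 1))) 0 ≠ 0) ↔
      (Delta F0 g 0 = 0 ∧ fderiv ℝ (Delta F0 g) 0 ≠ 0) := by
  have hF : ∀ w, ContDiff ℝ (⊤ : ℕ∞) (fun u => fderiv ℝ F0 u w) := fun w =>
    ContDiff.clm_apply (hF0.fderiv_right (m := (⊤ : ℕ∞)) (by simp)) contDiff_const
  have hin : ContDiff ℝ (⊤ : ℕ∞) (fun u : ℝ × ℝ => (u, (0:ℝ))) := by fun_prop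
  have hgc : ContDiff ℝ (⊤ : ℕ∞) (fun u : ℝ × ℝ => g (u, 0)) := hg.comp hin
  have hnc : ContDiff ℝ (⊤ : ℕ∞) (fun u : ℝ × ℝ => n (u, 0)) := hn.comp hin
  have hgx : ContDiff ℝ (⊤ : ℕ∞) (fun u : ℝ × ℝ => fderiv ℝ g (u, 0) (0, 1)) :=
    ContDiff.clm_apply ((hg.fderiv_right (m := (⊤ : ℕ∞)) (by simp)).comp hin) contDiff_const
  have hdotc : ∀ {a b : ℝ × ℝ → E4}, Continuous a → Continuous b →
      Continuous (fun u => dot4 (a u) (b u)) := by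
    intro a b ha hb
    simp only [dot4]
    exact continuous_finsetSum _ fun i _ => ((continuous_apply i).comp ha).mul ((continuous_apply i).comp hb)
  refine zero_cond (D1 := fun u => det4 (fderiv ℝ F0 u (1, 0)) (fderiv ℝ F0 u (0, 1)) (n (u, 0))
        (fderiv ℝ n (u, 0) (0, 1))) (D2 := Delta F0 g) (a0 := fun u => u)
    (c := fun u => det4 (fderiv ℝ F0 u (1, 0)) (fderiv ℝ F0 u (0, 1)) (g (u, 0)) (n (u, 0)) ^ 2)
    (k := fun u => 3 / 2 * (dot4 (fderiv ℝ F0 u (1, 0)) (fderiv ℝ F0 u (1, 0)) *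
      dot4 (fderiv ℝ F0 u (0, 1)) (fderiv ℝ F0 u (0, 1))
      - dot4 (fderiv ℝ F0 u (1, 0)) (fderiv ℝ F0 u (0, 1)) ^ 2) * dot4 (n (u, 0)) (n (u, 0)) ^ 2)
    ?_ ?_ ?_ ?_ ?_ ?_ ?_ ?_ ?_
  · exact (contDiffAt_det4 (hF _).contDiffAt (hF _).contDiffAt hgc.contDiffAt hnc.contDiffAt).continuousAt.pow 2
  · have k1 := (hF (1, 0)).continuous
    have k2 := (hF (0, 1)).continuous
    exact ((continuous_const.mul (((hdotc k1 k1).mul (hdotc k2 k2)).sub ((hdotc k1 k2).pow 2))).mul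
      ((hdotc hnc.continuous hnc.continuous).pow 2)).continuousAt
  · exact pow_ne_zero 2 hd
  · refine mul_ne_zero (mul_ne_zero (by norm_num) (gram2_ne hd)) (pow_ne_zero 2 ?_)
    intro h0
    have hn0 : n 0 = 0 := by
      have h0 : dot4 (n 0) (n 0) = 0 := h0
      simp only [dot4] at h0
      rw [Finset.sum_eq_zero_iff_of_nonneg (fun i _ => mul_self_nonneg _)] at h0
      ext i
      exact mul_self_eq_zero.1 (h0 i (Finset.mem_univ i))
    apply hd
    rw [hn0, det4_expand]; simp
  · exact differentiableAt_id
  · rfl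
  · have : fderiv ℝ (fun u : ℝ × ℝ => u) 0 = ContinuousLinearMap.id ℝ _ := fderiv_id
    rw [this]; exact Function.surjective_id
  · exact (contDiffAt_det4 (hF _).contDiffAt (hF _).contDiffAt hgc.contDiffAt hgx.contDiffAt).differentiableAt (by simp)
  · filter_upwards [ortho hF0 hg hn h] with u hu
    exact psi_alg (hu.1 _).1 (hu.1 _).1 hu.2.1 (hu.1 _).2 (hu.1 _).2 hu.2.2

/-- Criterion for the cuspidal cross cap × interval: a frontal `f` with normal `ν`,
identifier of singularities `lam`, null vector field `η` with `ηlam(0) ≠ 0`, and a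
parametrization `Sig` of the singular set, is a cuspidal cross cap × interval at `0`
iff `ψ(0) = 0` and `dψ₀ ≠ 0`, where
`ψ(t,r) = det(f̂_t, f̂_r, ν∘Sig, (ην)∘Sig)` and `f̂ = f ∘ Sig`. -/
theorem stmt10
    (f : ℝ × ℝ × ℝ → E4) (ν : ℝ × ℝ × ℝ → E4)
    (lam : ℝ × ℝ × ℝ → ℝ) (η : ℝ × ℝ × ℝ → ℝ × ℝ × ℝ)
    (Sig : ℝ × ℝ → ℝ × ℝ × ℝ) (ψ : ℝ × ℝ → ℝ)
    (hf : ContDiff ℝ (⊤ : ℕ∞) f) (hf0 : f 0 = 0)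
    -- ν is a (not necessarily unit) normal vector of the frontal f
    (hν : ContDiff ℝ (⊤ : ℕ∞) ν)
    (hν0 : ∀ᶠ q in 𝓝 (0 : ℝ × ℝ × ℝ), ν q ≠ 0)
    (hnormal : ∀ᶠ q in 𝓝 (0 : ℝ × ℝ × ℝ),
      ∀ v : ℝ × ℝ × ℝ, dot4 (fderiv ℝ f q v) (ν q) = 0)
    -- lam is an identifier of singularities
    (hlam : ContDiff ℝ (⊤ : ℕ∞) lam)
    (hident : ∃ c : ℝ × ℝ × ℝ → ℝ, ContDiff ℝ (⊤ : ℕ∞) c ∧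
      (∀ᶠ q in 𝓝 (0 : ℝ × ℝ × ℝ), c q ≠ 0) ∧
      ∀ᶠ q in 𝓝 (0 : ℝ × ℝ × ℝ), lam q =
        c q * det4 (fderiv ℝ f q (1,0,0)) (fderiv ℝ f q (0,1,0))
          (fderiv ℝ f q (0,0,1)) (ν q))
    -- rank df₀ = 2 and η is a null vector field
    (hrank : Module.finrank ℝ ↥(LinearMap.range (fderiv ℝ f 0).toLinearMap) = 2)
    (hη : ContDiff ℝ (⊤ : ℕ∞) η)
    (hnull : ∀ᶠ q in 𝓝 (0 : ℝ × ℝ × ℝ), lam q = 0 →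
      LinearMap.ker (fderiv ℝ f q).toLinearMap = Submodule.span ℝ {η q})
    -- non-degeneracy: ηlam(0) ≠ 0
    (hηlam : fderiv ℝ lam 0 (η 0) ≠ 0)
    -- Sig parametrizes the singular set S(f) = lam⁻¹(0) near 0
    (hSig : ContDiff ℝ (⊤ : ℕ∞) Sig) (hSig0 : Sig 0 = 0)
    (hSigimm : Function.Injective (fderiv ℝ Sig 0))
    (hSigsing : ∀ᶠ u in 𝓝 (0 : ℝ × ℝ), lam (Sig u) = 0)
    (hSigonto : ∀ᶠ q in 𝓝 (0 : ℝ × ℝ × ℝ), lam q = 0 → q ∈ Set.range Sig)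
    -- the function ψ
    (hψ : ψ = fun u => det4 (fderiv ℝ (f ∘ Sig) u (1,0)) (fderiv ℝ (f ∘ Sig) u (0,1))
      (ν (Sig u)) (fderiv ℝ ν (Sig u) (η (Sig u)))) :
    AEquivAt f 0 (fun q => ![q.1, q.2.1, q.2.2^2, q.2.1 * q.2.2^3]) ↔
      (ψ 0 = 0 ∧ fderiv ℝ ψ 0 ≠ 0) := by
  let Ψ : (ℝ × ℝ) × ℝ → ℝ × ℝ × ℝ := fun q => Sig q.1 + q.2 • η (Sig q.1)
  have hΨ : ContDiff ℝ (⊤ : ℕ∞) Ψ :=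
    (hSig.comp contDiff_fst).add (contDiff_snd.smul (hη.comp (hSig.comp contDiff_fst)))
  have hΨu : ∀ u, Ψ (u, 0) = Sig u := fun u => by simp [Ψ]
  have hΨ0 : Ψ 0 = 0 := by simp [Ψ, hSig0]
  have hΨt : Tendsto Ψ (𝓝 0) (𝓝 0) := by
    have := hΨ.continuous.tendsto 0
    rwa [hΨ0] at this
  have hSigt : Tendsto Sig (𝓝 0) (𝓝 0) := by
    have := hSig.continuous.tendsto 0
    rwa [hSig0] at this
  have hΨd : ∀ q, HasFDerivAt Ψ (fderiv ℝ Ψ q) q := fun q => (hΨ.differentiable (by simp) q).hasFDerivAt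
  have hΨx : ∀ u, fderiv ℝ Ψ (u, 0) (0, 1) = η (Sig u) := by
    intro u
    have hl : HasDerivAt (fun x : ℝ => (u, x)) ((0 : ℝ × ℝ), (1:ℝ)) 0 :=
      (hasDerivAt_const (0:ℝ) u).prodMk (hasDerivAt_id (0:ℝ))
    have h1 := HasFDerivAt.comp_hasDerivAt (0:ℝ) (hΨd (u, 0)) hl
    have h2 : HasDerivAt (fun x : ℝ => Sig u + x • η (Sig u)) (η (Sig u)) 0 := by
      have := ((hasDerivAt_id (0:ℝ)).smul_const (η (Sig u))).const_add (Sig u)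
      simpa using this
    exact h1.unique h2
  have hΨw : ∀ w : ℝ × ℝ, fderiv ℝ Ψ 0 (w, 0) = fderiv ℝ Sig 0 w := by
    intro w
    have h1 : HasFDerivAt (fun u : ℝ × ℝ => Ψ (u, 0)) ((fderiv ℝ Ψ (0, 0)).comp (ContinuousLinearMap.inl ℝ (ℝ × ℝ) ℝ)) 0 :=
      HasFDerivAt.comp (g := Ψ) (f := fun u : ℝ × ℝ => (u, (0:ℝ))) (0 : ℝ × ℝ) (hΨd (0, 0)) (hasFDerivAt_prodMk_left (0 : ℝ × ℝ) (0:ℝ))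
    simp only [hΨu] at h1
    have h2 := h1.unique (hSig.differentiable (by simp) 0).hasFDerivAt
    exact DFunLike.congr_fun h2 w
  have hlamSig : ∀ w, fderiv ℝ lam 0 (fderiv ℝ Sig 0 w) = 0 := by
    intro w
    have h0 : HasFDerivAt lam (fderiv ℝ lam 0) (Sig 0) := by
      rw [hSig0]; exact (hlam.differentiable (by simp) 0).hasFDerivAt
    have h1 := HasFDerivAt.comp (0 : ℝ × ℝ) h0 (hSig.differentiable (by simp) 0).hasFDerivAt
    have h2 := h1.unique ((hasFDerivAt_const (0:ℝ) (0 : ℝ × ℝ)).congr_of_eventuallyEq hSigsing)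
    exact DFunLike.congr_fun h2 w
  have hη0 : fderiv ℝ Ψ 0 (0, 1) = η 0 := by
    have := hΨx 0
    rw [hSig0] at this; exact this
  have hΨlin : ∀ w : (ℝ × ℝ) × ℝ, fderiv ℝ Ψ 0 w = w.1.1 • fderiv ℝ Sig 0 (1, 0)
      + w.1.2 • fderiv ℝ Sig 0 (0, 1) + w.2 • η 0 := by
    intro w
    rw [← hΨw, ← hΨw, ← hη0, ← map_smul, ← map_smul, ← map_smul, ← map_add, ← map_add]
    simp
  have hΨb : Function.Bijective (fderiv ℝ Ψ 0) := by
    have hi : ∀ w, fderiv ℝ Ψ 0 w = 0 → w = 0 := by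
      intro w hw
      have h1 : fderiv ℝ Ψ 0 w = fderiv ℝ Sig 0 w.1 + w.2 • η 0 := by
        rw [← hΨw, ← hη0, ← map_smul, ← map_add]; simp
      rw [h1] at hw
      have h2 := congrArg (fderiv ℝ lam 0) hw
      rw [map_add, hlamSig, map_smul, map_zero, zero_add, smul_eq_mul] at h2
      have h3 : w.2 = 0 := (mul_eq_zero.1 h2).resolve_right hηlam
      rw [h3, zero_smul, add_zero] at hw
      have h4 := hSigimm (hw.trans (map_zero _).symm)
      exact Prod.ext h4 h3
    have hi' : Function.Injective (fderiv ℝ Ψ 0 : ((ℝ × ℝ) × ℝ) →ₗ[ℝ] (ℝ × ℝ × ℝ)) :=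
      (injective_iff_map_eq_zero _).2 hi
    exact ⟨hi', (LinearMap.injective_iff_surjective_of_finrank_eq_finrank (by simp)).1 hi'⟩
  let F0 : ℝ × ℝ → E4 := f ∘ Sig
  have hF0 : ContDiff ℝ (⊤ : ℕ∞) F0 := hf.comp hSig
  have hfd : ∀ q, HasFDerivAt f (fderiv ℝ f q) q := fun q => (hf.differentiable (by simp) q).hasFDerivAt
  have hf1 : ContDiff ℝ (⊤ : ℕ∞) (f ∘ Ψ) := hf.comp hΨ
  have hf1d : ∀ q w, fderiv ℝ (f ∘ Ψ) q w = fderiv ℝ f (Ψ q) (fderiv ℝ Ψ q w) := by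
    intro q w
    rw [((hfd (Ψ q)).comp q (hΨd q)).fderiv]; rfl
  obtain ⟨g, hg, hgeq⟩ := hadamard_twice hf1 (by
    filter_upwards [hSigsing, hSigt.eventually hnull] with u h1 h2
    rw [hf1d, hΨx, hΨu]
    have : η (Sig u) ∈ LinearMap.ker (fderiv ℝ f (Sig u)).toLinearMap := by
      rw [h2 h1]; exact Submodule.mem_span_singleton_self _
    exact this)
  have hfst : Tendsto (fun q : (ℝ × ℝ) × ℝ => q.1) (𝓝 0) (𝓝 0) := by
    have : Continuous (fun q : (ℝ × ℝ) × ℝ => q.1) := continuous_fst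
    exact this.tendsto 0
  have hgq : ∀ᶠ q in 𝓝 (0 : (ℝ × ℝ) × ℝ), F0 q.1 + q.2 ^ 2 • g q = f (Ψ q) := by
    filter_upwards [hfst.eventually hgeq] with q hq
    have := hq q.2
    simp only [Function.comp, hΨu] at this
    exact this.symm
  -- normal
  let n : (ℝ × ℝ) × ℝ → E4 := ν ∘ Ψ
  have hn : ContDiff ℝ (⊤ : ℕ∞) n := hν.comp hΨ
  have hort : ∀ᶠ q in 𝓝 (0 : (ℝ × ℝ) × ℝ), ∀ w,
      dot4 (fderiv ℝ (fun q : (ℝ × ℝ) × ℝ => F0 q.1 + q.2 ^ 2 • g q) q w) (n q) = 0 := by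
    filter_upwards [hgq.eventually_nhds, hΨt.eventually hnormal] with q h1 h2 w
    have h3 : fderiv ℝ (fun q : (ℝ × ℝ) × ℝ => F0 q.1 + q.2 ^ 2 • g q) q = fderiv ℝ (f ∘ Ψ) q :=
      Filter.EventuallyEq.fderiv_eq h1
    rw [h3, hf1d]
    exact h2 _
  have hnx : ∀ u, fderiv ℝ n (u, 0) (0, 1) = fderiv ℝ ν (Sig u) (η (Sig u)) := by
    intro u
    have h1 := ((hν.differentiable (by simp) (Ψ (u, 0))).hasFDerivAt.comp (u, (0:ℝ)) (hΨd (u, 0))).fderiv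
    rw [h1, ContinuousLinearMap.comp_apply, hΨx, hΨu]
  have hnu : ∀ u, n (u, 0) = ν (Sig u) := fun u => congrArg ν (hΨu u)
  have hn0 : n 0 = ν 0 := congrArg ν hΨ0
  have hF0d : ∀ w, fderiv ℝ F0 0 w = fderiv ℝ f 0 (fderiv ℝ Sig 0 w) := by
    intro w
    have h1 := ((hfd (Sig 0)).comp (0 : ℝ × ℝ) (hSig.differentiable (by simp) 0).hasFDerivAt).fderiv
    rw [h1, ContinuousLinearMap.comp_apply, hSig0]
  -- nondegeneracy
  have hd : det4 (fderiv ℝ F0 0 (1, 0)) (fderiv ℝ F0 0 (0, 1)) (g 0) (n 0) ≠ 0 := by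
    intro hd0
    apply hηlam
    obtain ⟨c, hc, hc0, hlc⟩ := hident
    obtain ⟨c1, hc1⟩ := hΨb.2 (1, 0, 0)
    obtain ⟨c2, hc2⟩ := hΨb.2 (0, 1, 0)
    obtain ⟨c3, hc3⟩ := hΨb.2 (0, 0, 1)
    rw [hΨlin] at hc1 hc2 hc3
    let K : ℝ := c1.1.1 * (c2.1.2 * c3.2 - c2.2 * c3.1.2) - c1.1.2 * (c2.1.1 * c3.2 - c2.2 * c3.1.1)
      + c1.2 * (c2.1.1 * c3.1.2 - c2.1.2 * c3.1.1)
    have hK : ∀ (L : (ℝ × ℝ × ℝ) →L[ℝ] E4) (m : E4), det4 (L (1,0,0)) (L (0,1,0)) (L (0,0,1)) m =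
        K * det4 (L (fderiv ℝ Sig 0 (1, 0))) (L (fderiv ℝ Sig 0 (0, 1))) (L (η 0)) m := by
      intro L m
      rw [← hc1, ← hc2, ← hc3]
      simp only [map_add, map_smul]
      exact det4_lin3 _ _ _ m (c1.1.1, c1.1.2, c1.2) (c2.1.1, c2.1.2, c2.2) (c3.1.1, c3.1.2, c3.2)
    -- derivative along the null line
    have hline : ∀ x : ℝ, f (x • η 0) = F0 0 + x ^ 2 • g (0, x) := by
      intro x
      have := hgeq.self_of_nhds x
      simp only [Function.comp, hΨu] at this
      have h2 : Ψ (0, x) = x • η 0 := by simp [Ψ, hSig0]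
      rw [h2] at this
      exact this
    have hfx : ∀ x : ℝ, fderiv ℝ f (x • η 0) (η 0) =
        x • ((2:ℝ) • g (0, x) + x • fderiv ℝ g (0, x) (0, 1)) := by
      intro x
      have h1 : HasDerivAt (fun x : ℝ => x • η 0) (η 0) x := by
        simpa using (hasDerivAt_id x).smul_const (η 0)
      have h2 := (hfd (x • η 0)).comp_hasDerivAt x h1
      have hl : HasDerivAt (fun x : ℝ => ((0 : ℝ × ℝ), x)) ((0 : ℝ × ℝ), (1:ℝ)) x :=
        (hasDerivAt_const x _).prodMk (hasDerivAt_id x)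
      have hgv : HasDerivAt (fun x : ℝ => g (0, x)) (fderiv ℝ g (0, x) (0, 1)) x :=
        HasFDerivAt.comp_hasDerivAt x (hg.differentiable (by simp) (0, x)).hasFDerivAt hl
      have h3 := (((hasDerivAt_id x).pow 2).smul hgv).const_add (F0 0)
      have h4 := h2.unique (h3.congr_of_eventuallyEq (Eventually.of_forall fun x => hline x))
      rw [h4]
      simp [smul_smul]
      rw [add_comm, mul_comm, pow_two]
    let R : ℝ → ℝ := fun x => c (x • η 0) * K * det4 (fderiv ℝ f (x • η 0) (fderiv ℝ Sig 0 (1, 0)))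
      (fderiv ℝ f (x • η 0) (fderiv ℝ Sig 0 (0, 1)))
      ((2:ℝ) • g (0, x) + x • fderiv ℝ g (0, x) (0, 1)) (ν (x • η 0))
    have hlx : ContDiff ℝ (⊤ : ℕ∞) (fun x : ℝ => x • η 0) := contDiff_id.smul contDiff_const
    have hRc : ContinuousAt R 0 := by
      have k1 : ∀ w, ContDiff ℝ (⊤ : ℕ∞) (fun x : ℝ => fderiv ℝ f (x • η 0) w) := fun w =>
        ContDiff.clm_apply ((hf.fderiv_right (m := (⊤ : ℕ∞)) (by simp)).comp hlx) contDiff_const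
      have hx0 : ContDiff ℝ (⊤ : ℕ∞) (fun x : ℝ => ((0 : ℝ × ℝ), x)) := contDiff_const.prodMk contDiff_id
      have k2 : ContDiff ℝ (⊤ : ℕ∞) (fun x : ℝ => fderiv ℝ g (0, x) (0, 1)) :=
        ContDiff.clm_apply ((hg.fderiv_right (m := (⊤ : ℕ∞)) (by simp)).comp hx0) contDiff_const
      have k4 : ContDiff ℝ (⊤ : ℕ∞) (fun x : ℝ => g (0, x)) := hg.comp hx0
      have k5 : ContDiff ℝ (⊤ : ℕ∞) (fun x : ℝ => (2:ℝ) • g (0, x)) := k4.const_smul (2:ℝ)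
      have k6 : ContDiff ℝ (⊤ : ℕ∞) (fun x : ℝ => x • fderiv ℝ g (0, x) (0, 1)) := contDiff_id.smul k2
      have k3 : ContDiff ℝ (⊤ : ℕ∞) (fun x : ℝ => (2:ℝ) • g (0, x) + x • fderiv ℝ g (0, x) (0, 1)) :=
        k5.add k6
      exact (((hc.comp hlx).continuous.continuousAt).mul continuousAt_const).mul
        (contDiffAt_det4 (k1 _).contDiffAt (k1 _).contDiffAt k3.contDiffAt (hν.comp hlx).contDiffAt).continuousAt
    have hR0 : R 0 = 0 := by
      have h1 : R 0 = c 0 * K * (2 * det4 (fderiv ℝ F0 0 (1, 0)) (fderiv ℝ F0 0 (0, 1)) (g 0) (n 0)) := by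
        simp only [R, zero_smul, add_zero, hF0d, hn0]
        simp only [det4_expand, Pi.smul_apply, smul_eq_mul]
        rw [show ((0 : ℝ × ℝ), (0 : ℝ)) = 0 from rfl]
        ring
      rw [h1, hd0]; ring
    have ht : Tendsto (fun x : ℝ => x • η 0) (𝓝 0) (𝓝 0) := by
      have := hlx.continuous.tendsto 0
      simpa using this
    have hle : ∀ᶠ x in 𝓝 (0:ℝ), lam (x • η 0) = R x * x := by
      filter_upwards [ht.eventually hlc] with x hx
      rw [hx, hK, hfx]
      simp only [R, det4_expand]
      simp
      ring
    have d1 : HasFDerivAt (fun x : ℝ => R x * x) (R 0 • ContinuousLinearMap.id ℝ ℝ) 0 :=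
      hasFDerivAt_mul_vanish hRc (hasFDerivAt_id (0:ℝ)) rfl
    have d2 := (d1.congr_of_eventuallyEq hle).hasDerivAt
    have h1 : HasDerivAt (fun x : ℝ => x • η 0) (η 0) 0 := by
      simpa using (hasDerivAt_id (0:ℝ)).smul_const (η 0)
    have h0 : HasFDerivAt lam (fderiv ℝ lam 0) ((0:ℝ) • η 0) := by
      rw [zero_smul]; exact (hlam.differentiable (by simp) 0).hasFDerivAt
    have d3 := h0.comp_hasDerivAt (0:ℝ) h1
    have := d3.unique d2
    rw [this, hR0]; simp
  have hψ' : ψ = fun u => det4 (fderiv ℝ F0 u (1, 0)) (fderiv ℝ F0 u (0, 1)) (n (u, 0))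
        (fderiv ℝ n (u, 0) (0, 1)) := by
    rw [hψ]
    funext u
    rw [hnu, hnx]
  have hpd := psi_delta hF0 hg hn hort hd
  have hψiff : (ψ 0 = 0 ∧ fderiv ℝ ψ 0 ≠ 0) ↔ (Delta F0 g 0 = 0 ∧ fderiv ℝ (Delta F0 g) 0 ≠ 0) := by
    rw [← hpd, hψ']
  rw [hψiff]
  have hF00 : F0 0 = f 0 := congrArg f hSig0
  constructor
  · rintro ⟨φ, Φ, hφ, hΦ, hφ0, hΦ0, heq⟩
    have hφΨ : ContDiffAt ℝ (⊤ : ℕ∞) φ (Ψ 0) := by rw [hΨ0]; exact hφ.1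
    refine nec (φ := φ ∘ Ψ) (Φ := Φ) hF0 hg (hφΨ.comp 0 hΨ.contDiffAt) ?_ ?_ ?_ ?_
    · have h1 := (hφΨ.differentiableAt (by simp)).hasFDerivAt.comp (0 : (ℝ × ℝ) × ℝ) (hΨd 0)
      rw [h1.fderiv, hΨ0]
      exact hφ.2.1.comp hΨb.1
    · simp [hΨ0, hφ0]
    · rw [hF00]; exact hΦ
    · filter_upwards [hgq, hΨt.eventually heq] with q h1 h2
      rw [h1, h2]; rfl
  · intro hD
    obtain ⟨φ, Φ, hφ, hφb, hφ0, hΦ, hΦ0, heq⟩ := suff hF0 hg hd hD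
    obtain ⟨T, hT0, hTs, hTL, hTR, hTd, hTb⟩ :=
      local_inv (T := Ψ) (p := 0) (Eventually.of_forall fun q => hΨ.contDiffAt) hΨb
    rw [hΨ0] at hT0 hTs hTR hTd hTb
    have hTt : Tendsto T (𝓝 0) (𝓝 0) := by
      have := hTs.self_of_nhds.continuousAt
      rwa [ContinuousAt, hT0] at this
    have hφT : ContDiffAt ℝ (⊤ : ℕ∞) φ (T 0) := by rw [hT0]; exact hφ
    refine ⟨φ ∘ T, Φ, ⟨hφT.comp 0 hTs.self_of_nhds, ?_⟩, ?_, ?_, ?_, ?_⟩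
    · have h1 := (hφT.differentiableAt (by simp)).hasFDerivAt.comp (0 : ℝ × ℝ × ℝ)
        (hTs.self_of_nhds.differentiableAt (by simp)).hasFDerivAt
      rw [h1.fderiv, hT0]
      exact hφb.comp hTb
    · rw [← hF00]; exact hΦ
    · simp [hT0, hφ0]
    · rw [← hF00, hΦ0]
      ext i
      fin_cases i <;> simp
    · filter_upwards [hTt.eventually heq, hTt.eventually hgq, hTR] with q h1 h2 h3
      rw [h2, h3] at h1
      exact h1
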